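/- Let r = (R_j)_{j≥1} be a generic sequence of radii and let (ε_j)_{j≥1} be a sequence of positive real numbers. Then for every c = (c_j) ∈ C(r) there exist c' = (c'_j) ∈ C(r) with |c_j − c'_j| < ε_j for all j ≥ 1, and a point x ∈ ℂ_p, such that for every y ∈ ℂ_p with |y − x| < ϱ² the forward orbit of y under f_{c'} oscillates: sup_{n≥0} |f_{c'}^{∘n}(y)| = ∞ and |f_{c'}^{∘n}(y)| < 1 for infinitely many n. (This is the classical-points content of the statement that f_{c'} has an oscillating wandering Fatou domain containing the disk {|y − x| < ϱ²}.) -/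

import Mathlib

noncomputable section

/-- `K` is a model of `ℂ_p`, the completion of an algebraic closure of `ℚ_p`:
it is a complete, algebraically closed, nonarchimedean normed field whose norm
extends the `p`-adic absolute value and in which the algebraic elements over
`ℚ_p` are dense. -/
structure IsCp (p : ℕ) [Fact p.Prime] (K : Type*) [NormedField K] [Algebra ℚ_[p] K] : Prop where
  complete : CompleteSpace K
  norm_extends : ∀ x : ℚ_[p], ‖algebraMap ℚ_[p] K x‖ = ‖x‖
  isAlgClosed : IsAlgClosed K
  dense_algebraic : Dense {x : K | IsAlgebraic ℚ_[p] x}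
  isNonarch : ∀ x y : K, ‖x + y‖ ≤ max ‖x‖ ‖y‖

/-- `ϱ = p^{-1/(p-1)}`. -/
def rho (p : ℕ) : ℝ := (p : ℝ) ^ (-1 / ((p : ℝ) - 1))

/-- `R` is a sequence of radii: strictly increasing (for indices `≥ 1`),
with `R 1 > p`, tending to infinity. -/
def IsRadii (p : ℕ) (R : ℕ → ℝ) : Prop :=
  (∀ j, 1 ≤ j → R j < R (j + 1)) ∧ (p : ℝ) < R 1 ∧
    Filter.Tendsto R Filter.atTop Filter.atTop

/-- The piecewise-monomial map `φ`: for `R_{j-1} < t ≤ R_j` (with `R_0 := 0`),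
`φ(t) = p (R_1 ⋯ R_{j-1})⁻¹ t^{p+j-1}`. -/
def phi (p : ℕ) (R : ℕ → ℝ) (t : ℝ) : ℝ :=
  let j := sInf {j : ℕ | 1 ≤ j ∧ t ≤ R j}
  (p : ℝ) * (∏ i ∈ Finset.Icc 1 (j - 1), R i)⁻¹ * t ^ (p + j - 1)

/-- A generic sequence of radii. -/
def IsGenericRadii (p : ℕ) (R : ℕ → ℝ) : Prop :=
  IsRadii p R ∧ ∀ i j n : ℕ, 1 ≤ i → i < j → 1 ≤ n → (phi p R)^[n] (R i) ≠ R j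

/-- Membership in the parameter space `C(r)`: `|c_j| = R_j` for all `j ≥ 1`. -/
def InC (p : ℕ) [Fact p.Prime] {K : Type*} [NormedField K] (R : ℕ → ℝ) (c : ℕ → K) : Prop :=
  ∀ j, 1 ≤ j → ‖c j‖ = R j

/-- The transcendental entire map `f_c(z) = (z^p/p) ∏_{j ≥ 1} (1 - z/c_j)`. -/
def fc (p : ℕ) {K : Type*} [NormedField K] (c : ℕ → K) (z : K) : K :=
  z ^ p / (p : K) * ∏' j : ℕ, (1 - z / c (j + 1))

/-- The disk `B_0 = {|z| < 1}` for `j = 0`, and `B_j = {|z - c_j| < R_j}` for `j ≥ 1`. -/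
def Bset {K : Type*} [NormedField K] (R : ℕ → ℝ) (c : ℕ → K) (j : ℕ) : Set K :=
  if j = 0 then {z : K | ‖z‖ < 1} else {z : K | ‖z - c j‖ < R j}

/-- The set `A`, complement of all the disks `B_j`, `j ≥ 0`. -/
def Aset {K : Type*} [NormedField K] (R : ℕ → ℝ) (c : ℕ → K) : Set K :=
  (⋃ j, Bset R c j)ᶜ

/-- `n_j`, the minimal `n ≥ 1` with `R_j < φ^{∘(n+1)}(1)`. -/
def nseq (p : ℕ) (R : ℕ → ℝ) (j : ℕ) : ℕ :=
  sInf {n : ℕ | 1 ≤ n ∧ R j < (phi p R)^[n + 1] 1}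

/-- `S_j = φ⁻¹(R_j)`. -/
def Sse (p : ℕ) (R : ℕ → ℝ) (j : ℕ) : ℝ := Function.invFun (phi p R) (R j)

/-- `λ_j = φ(R_j)/R_j`. -/
def lam (p : ℕ) (R : ℕ → ℝ) (j : ℕ) : ℝ := phi p R (R j) / R j

/-- `L_k`: index of the first symbol of the `k`-th block `B_0^{m_k} A^{n_k} B_k^{…}`
of the itinerary `α(m, ℓ)`; `L_1 = 0` and `L_{k+1} = L_k + m_k + n_k + ℓ_{k+1}`. -/
def Lseq (m n l : ℕ → ℕ) : ℕ → ℕ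
  | 0 => 0
  | 1 => 0
  | k + 2 => Lseq m n l (k + 1) + m (k + 1) + n (k + 1) + l (k + 2)

/-- `N_k = L_k + m_k + n_k`, the index of the final symbol `B_k` of the truncated
itinerary `α^{(k)}` (so `α^{(k)}` has length `N_k + 1`). -/
def Nseq (m n l : ℕ → ℕ) (k : ℕ) : ℕ := Lseq m n l k + m k + n k

/-- The symbol (`some 0 = B_0`, `none = A`, `some k = B_k`) at position `i` of the
itinerary `α(m,ℓ) = B_0^{m_1} A^{n_1} B_1^{ℓ_2} B_0^{m_2} A^{n_2} B_2^{ℓ_3} ⋯`. -/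
def itin (m n l : ℕ → ℕ) (i : ℕ) : Option ℕ :=
  let k := sSup {k : ℕ | 1 ≤ k ∧ Lseq m n l k ≤ i}
  if i < Lseq m n l k + m k then some 0
  else if i < Lseq m n l k + m k + n k then none
  else some k

/-- The subset of `ℂ_p` corresponding to a symbol of the alphabet `{A, B_0, B_1, …}`. -/
def symbSet {K : Type*} [NormedField K] (R : ℕ → ℝ) (c : ℕ → K) : Option ℕ → Set K
  | none => Aset R c
  | some j => Bset R c j

/-- Condition (3.2) at `k`: `ϱ⁻¹ R_k p^{-m_k} λ_k^{ℓ_{k+1}} < 1`. -/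
def Cond32 (p : ℕ) (R : ℕ → ℝ) (m l : ℕ → ℕ) (k : ℕ) : Prop :=
  (rho p)⁻¹ * R k * ((p : ℝ) ^ m k)⁻¹ * lam p R k ^ l (k + 1) < 1

/-- Condition (3.3) for `k`: for all `2 ≤ j < k`,
`ε_k < ϱ^{k-j} R_k² (R_{j-1} S_{j-1})⁻¹ λ_{j-1}^{-ℓ_j}`. -/
def Cond33 (p : ℕ) (R : ℕ → ℝ) (ε : ℕ → ℝ) (l : ℕ → ℕ) (k : ℕ) : Prop :=
  ∀ j, 2 ≤ j → j < k →
    ε k < rho p ^ (k - j) * R k ^ 2 * (R (j - 1) * Sse p R (j - 1))⁻¹ *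
      (lam p R (j - 1) ^ l j)⁻¹

/-- Condition (3.4) for `k`: for all `2 ≤ j ≤ k`,
`ϱ^{-2} R_{j-1} S_{j-1} λ_{j-1}^{ℓ_j} p^{-m_j} < 1`. -/
def Cond34 (p : ℕ) (R : ℕ → ℝ) (m l : ℕ → ℕ) (k : ℕ) : Prop :=
  ∀ j, 2 ≤ j → j ≤ k →
    ((rho p) ^ 2)⁻¹ * (R (j - 1) * Sse p R (j - 1)) * lam p R (j - 1) ^ l j *
      ((p : ℝ) ^ m j)⁻¹ < 1

/-- Condition (3.5) at `k`: `p ϱ⁻¹ R_{k+1}² S_k⁻¹ λ_k^{-ℓ_{k+1}} < ε_{k+1}`. -/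
def Cond35 (p : ℕ) (R : ℕ → ℝ) (ε : ℕ → ℝ) (l : ℕ → ℕ) (k : ℕ) : Prop :=
  (p : ℝ) * (rho p)⁻¹ * R (k + 1) ^ 2 * (Sse p R k)⁻¹ * (lam p R k ^ l (k + 1))⁻¹ < ε (k + 1)

/-- `c' ∈ Δ_k(c, ε)`. -/
def InDelta (p : ℕ) [Fact p.Prime] {K : Type*} [NormedField K] (R : ℕ → ℝ) (c : ℕ → K)
    (ε : ℕ → ℝ) (k : ℕ) (c' : ℕ → K) : Prop :=
  InC p R c' ∧ (∀ j, 1 ≤ j → j < k → c' j = c j) ∧ ∀ j, k ≤ j → ‖c' j - c j‖ < ε j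

/-- `c' ∈ U_k(c, ε)`. -/
def InU (p : ℕ) [Fact p.Prime] {K : Type*} [NormedField K] (R : ℕ → ℝ) (c : ℕ → K)
    (k : ℕ) (ε : ℝ) (c' : ℕ → K) : Prop :=
  InC p R c' ∧ ‖c' k - c k‖ < ε ∧ ∀ j, 1 ≤ j → j ≠ k → c' j = c j

namespace OscillatingMap

open Filter Topology Polynomial

section Ultrametric

variable {K : Type*} [NormedField K] [IsUltrametricDist K]

lemma norm_sub_le_of_le {x y z : K} {η : ℝ} (h₁ : ‖x - y‖ ≤ η) (h₂ : ‖y - z‖ ≤ η) :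
    ‖x - z‖ ≤ η := by
  rw [← sub_add_sub_cancel x y z]
  exact (IsUltrametricDist.norm_add_le_max _ _).trans (max_le h₁ h₂)

lemma norm_sub_lt_of_lt {x y z : K} {η : ℝ} (h₁ : ‖x - y‖ < η) (h₂ : ‖y - z‖ < η) :
    ‖x - z‖ < η := by
  rw [← sub_add_sub_cancel x y z]
  exact (IsUltrametricDist.norm_add_le_max _ _).trans_lt (max_lt h₁ h₂)

lemma norm_le_of_norm_sub_le {x y : K} {η : ℝ} (h₁ : ‖x - y‖ ≤ η) (h₂ : ‖y‖ ≤ η) : ‖x‖ ≤ η := by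
  simpa using norm_sub_le_of_le (z := 0) h₁ (by simpa using h₂)

lemma norm_lt_of_norm_sub_lt {x y : K} {η : ℝ} (h₁ : ‖x - y‖ < η) (h₂ : ‖y‖ < η) : ‖x‖ < η := by
  simpa using norm_sub_lt_of_lt (z := 0) h₁ (by simpa using h₂)

lemma norm_sub_lt_of_norm_lt {x y : K} {η : ℝ} (h₁ : ‖x‖ < η) (h₂ : ‖y‖ < η) : ‖x - y‖ < η :=
  norm_sub_lt_of_lt (y := 0) (by simpa using h₁) (by simpa using h₂)

lemma norm_eq_of_norm_sub_lt {x y : K} (h : ‖x - y‖ < ‖y‖) : ‖x‖ = ‖y‖ := by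
  refine le_antisymm (norm_le_of_norm_sub_le h.le le_rfl) (not_lt.1 fun hlt => ?_)
  rw [norm_sub_rev] at h
  exact lt_irrefl _ (norm_lt_of_norm_sub_lt h hlt)

lemma norm_add_eq_of_lt {x y : K} (h : ‖x‖ < ‖y‖) : ‖x + y‖ = ‖y‖ :=
  norm_eq_of_norm_sub_lt (by simpa using h)

lemma norm_sub_eq_of_lt {x y : K} (h : ‖x‖ < ‖y‖) : ‖x - y‖ = ‖y‖ := by
  rw [norm_sub_rev]
  exact norm_eq_of_norm_sub_lt (by simpa using h)

lemma norm_prod_sub_prod_le {ι : Type*} (s : Finset ι) {a b : ι → K} {A : ι → ℝ} {θ : ℝ}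
    (hθ : 0 ≤ θ) (ha : ∀ i ∈ s, ‖a i‖ ≤ A i) (hb : ∀ i ∈ s, ‖b i‖ ≤ A i)
    (hab : ∀ i ∈ s, ‖a i - b i‖ ≤ θ * A i) :
    ‖∏ i ∈ s, a i - ∏ i ∈ s, b i‖ ≤ θ * ∏ i ∈ s, A i := by
  classical
  induction s using Finset.induction_on with
  | empty => simpa using hθ
  | insert i s hi ih =>
    have hA : ∀ j ∈ insert i s, 0 ≤ A j := fun j hj => (norm_nonneg _).trans (ha j hj)
    have ih' := ih (fun j hj => ha j (by simp [hj])) (fun j hj => hb j (by simp [hj]))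
      (fun j hj => hab j (by simp [hj]))
    have hAi := hA i (by simp)
    have hAs : 0 ≤ ∏ j ∈ s, A j := Finset.prod_nonneg fun j hj => hA j (by simp [hj])
    have hbs : ‖∏ j ∈ s, b j‖ ≤ ∏ j ∈ s, A j := by
      rw [norm_prod]
      exact Finset.prod_le_prod (fun _ _ => norm_nonneg _) fun j hj => hb j (by simp [hj])
    rw [Finset.prod_insert hi, Finset.prod_insert hi, Finset.prod_insert hi]
    refine norm_sub_le_of_le (y := a i * ∏ j ∈ s, b j) ?_ ?_
    · rw [← mul_sub, norm_mul]
      calc _ ≤ A i * (θ * ∏ j ∈ s, A j) :=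
            mul_le_mul (ha i (by simp)) ih' (norm_nonneg _) hAi
        _ = _ := by ring
    · rw [← sub_mul, norm_mul]
      calc _ ≤ (θ * A i) * ∏ j ∈ s, A j :=
            mul_le_mul (hab i (by simp)) hbs (norm_nonneg _) (by positivity)
        _ = _ := by ring

lemma norm_pow_sub_pow_le {z w : K} {T θ : ℝ} (hθ : 0 ≤ θ) (hz : ‖z‖ ≤ T) (hw : ‖w‖ ≤ T)
    (h : ‖z - w‖ ≤ θ * T) (n : ℕ) : ‖z ^ n - w ^ n‖ ≤ θ * T ^ n := by
  simpa using norm_prod_sub_prod_le (Finset.range n) (a := fun _ => z) (b := fun _ => w)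
    (A := fun _ => T) hθ (fun _ _ => hz) (fun _ _ => hw) (fun _ _ => h)

/-- If no factor of `∏ (X - ρ)` vanishes within the distance `‖v₁ - v₀‖` of `v₀`, the product
varies by less than its size. -/
lemma norm_multiset_prod_sub_lt {v₀ v₁ : K} (m : Multiset K)
    (hm : ∀ ρ ∈ m, ‖v₁ - v₀‖ < ‖v₀ - ρ‖) :
    ‖(m.map (v₁ - ·)).prod - (m.map (v₀ - ·)).prod‖ < ‖(m.map (v₀ - ·)).prod‖ := by
  induction m using Multiset.induction_on with
  | empty => simp
  | cons ρ m ih =>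
    have ih' := ih fun ρ' h => hm ρ' (by simp [h])
    have h := hm ρ (by simp)
    simp only [Multiset.map_cons, Multiset.prod_cons]
    have h1 : ‖v₁ - ρ‖ = ‖v₀ - ρ‖ := norm_eq_of_norm_sub_lt (by simpa using h)
    have hpos : 0 < ‖v₀ - ρ‖ := (norm_nonneg _).trans_lt h
    refine norm_sub_lt_of_lt (y := (v₁ - ρ) * (m.map (v₀ - ·)).prod) ?_ ?_
    · rw [← mul_sub, norm_mul, norm_mul, h1]
      exact mul_lt_mul_of_pos_left ih' hpos
    · rw [← sub_mul, norm_mul, norm_mul]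
      exact mul_lt_mul_of_pos_right (by simpa using h) ((norm_nonneg _).trans_lt ih')

end Ultrametric

section Polynomial

lemma exists_norm_mem_Ioo (K : Type*) [NontriviallyNormedField K] [IsAlgClosed K] {θ : ℝ} (hθ : θ < 1) : ∃ t : K, θ < ‖t‖ ∧ ‖t‖ < 1 := by
  obtain ⟨π, h0, h1⟩ := NormedField.exists_norm_lt_one K
  rcases lt_or_ge θ 0 with hneg | hnn
  · exact ⟨π, hneg.trans h0, h1⟩
  obtain ⟨n, hn⟩ := ((tendsto_pow_atTop_nhds_zero_of_lt_one hnn hθ).eventually_lt_const h0).exists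
  have hn0 : n ≠ 0 := by
    rintro rfl
    simp only [pow_zero] at hn
    exact lt_asymm hn h1
  obtain ⟨t, ht⟩ := IsAlgClosed.exists_pow_nat_eq π (Nat.pos_of_ne_zero hn0)
  have ht' : ‖t‖ ^ n = ‖π‖ := by rw [← norm_pow, ht]
  refine ⟨t, ?_, ?_⟩
  · by_contra! h
    have := pow_le_pow_left₀ (norm_nonneg t) h n
    linarith
  · by_contra! h
    have := one_le_pow₀ (n := n) h
    linarith

/-- `g` is a uniform limit of polynomials on `S`. -/
def PolyApprox {K : Type*} [NormedField K] (S : Set K) (g : K → K) : Prop :=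
  ∀ η > 0, ∃ P : K[X], ∀ v ∈ S, ‖g v - P.eval v‖ < η

lemma polyApprox_eval {K : Type*} [NormedField K] (S : Set K) (P : K[X]) : PolyApprox S fun v => P.eval v :=
  fun η hη => ⟨P, fun v _ => by simpa using hη⟩

lemma PolyApprox.mono {K : Type*} [NormedField K] {S S' : Set K} {g : K → K} (hg : PolyApprox S g) (hS : S' ⊆ S) : PolyApprox S' g :=
  fun η hη => (hg η hη).imp fun _ hP v hv => hP v (hS hv)

variable {K : Type*} [NontriviallyNormedField K] [IsUltrametricDist K] [IsAlgClosed K]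

/-- The image of a disk under a polynomial contains, along with two points, every point that is
at most as far from the first as the second is. -/
lemma exists_eval_eq (P : K[X]) {v₀ v₁ w : K}
    (hw : ‖w - P.eval v₀‖ ≤ ‖P.eval v₁ - P.eval v₀‖) :
    ∃ v, ‖v - v₀‖ ≤ ‖v₁ - v₀‖ ∧ P.eval v = w := by
  by_contra! hcon
  set Q := P - C w with hQ
  have hQv : ∀ v, Q.eval v = P.eval v - w := fun v => by simp [hQ]
  have hsplit := IsAlgClosed.splits Q
  have hroot : ∀ ρ ∈ Q.roots, ‖v₁ - v₀‖ < ‖v₀ - ρ‖ := by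
    intro ρ hρ
    by_contra! hle
    refine hcon ρ (by rwa [norm_sub_rev]) ?_
    have := (Polynomial.mem_roots'.1 hρ).2
    rw [IsRoot, hQv] at this
    exact sub_eq_zero.1 this
  have hQ0 : Q ≠ 0 := by
    intro h0
    refine hcon v₀ (by simp) ?_
    have := hQv v₀
    rw [h0] at this
    rw [eval_zero] at this
    exact sub_eq_zero.1 this.symm
  have hlt : ‖Q.eval v₁ - Q.eval v₀‖ < ‖Q.eval v₀‖ := by
    rw [hsplit.eval_eq_prod_roots, hsplit.eval_eq_prod_roots, ← mul_sub, norm_mul, norm_mul]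
    exact mul_lt_mul_of_pos_left (norm_multiset_prod_sub_lt _ hroot)
      (norm_pos_iff.2 (leadingCoeff_ne_zero.2 hQ0))
  rw [hQv, hQv, sub_sub_sub_cancel_right, norm_sub_rev _ w] at hlt
  exact absurd hw (not_le.2 hlt)

lemma exists_closer_norm_eval_gt (P : K[X]) {v₀ v : K} {τ : ℝ} (hv : v ≠ v₀)
    (hτ : τ < ‖P.eval v‖) : ∃ w, ‖w - v₀‖ < ‖v - v₀‖ ∧ τ < ‖P.eval w‖ := by
  classical
  set s := ‖v - v₀‖ with hs
  have hs0 : 0 < s := norm_pos_iff.2 (sub_ne_zero.2 hv)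
  have hev : ∀ᶠ x : ℝ in 𝓝 1, (∀ ρ ∈ P.roots.toFinset, ‖v₀ - ρ‖ < s → ‖v₀ - ρ‖ < x * s) ∧
      τ < x ^ P.roots.card * ‖P.eval v‖ := by
    refine ((P.roots.toFinset.eventually_all).2 fun ρ _ => ?_).and ?_
    · by_cases h : ‖v₀ - ρ‖ < s
      · have : ContinuousAt (fun x : ℝ => x * s) 1 := by fun_prop
        filter_upwards [this.eventually_const_lt (u := ‖v₀ - ρ‖) (by simpa using h)] with x hx _
        exact hx
      · exact Eventually.of_forall fun _ h' => absurd h' h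
    · have : ContinuousAt (fun x : ℝ => x ^ P.roots.card * ‖P.eval v‖) 1 := by fun_prop
      exact this.eventually_const_lt (by simpa using hτ)
  obtain ⟨l, hl1, hl⟩ := exists_Ioc_subset_of_mem_nhds hev ⟨0, zero_lt_one⟩
  obtain ⟨t, htl, ht1⟩ := exists_norm_mem_Ioo K hl1
  obtain ⟨hρ, hdeg⟩ := hl ⟨htl, ht1.le⟩
  refine ⟨v₀ + t * (v - v₀), ?_, hdeg.trans_le ?_⟩
  · rw [add_sub_cancel_left, norm_mul, ← hs]
    exact mul_lt_of_lt_one_left hs0 ht1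
  have hfac : ∀ ρ ∈ P.roots, ‖t‖ * ‖v - ρ‖ ≤ ‖v₀ + t * (v - v₀) - ρ‖ := by
    intro ρ hmem
    rcases lt_or_ge ‖v₀ - ρ‖ s with h | h
    · have h1 : ‖v - ρ‖ = s := by
        rw [← sub_add_sub_cancel v v₀ ρ, add_comm]
        exact norm_add_eq_of_lt h
      have h2 : ‖v₀ - ρ‖ < ‖t * (v - v₀)‖ := by
        rw [norm_mul]
        exact hρ ρ (by simpa using hmem) h
      rw [add_sub_right_comm, norm_add_eq_of_lt h2, norm_mul, h1]
    · have h2 : ‖t * (v - v₀)‖ < ‖v₀ - ρ‖ := by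
        rw [norm_mul]
        exact (mul_lt_of_lt_one_left hs0 ht1).trans_le h
      rw [add_sub_right_comm, add_comm, norm_add_eq_of_lt h2]
      have h3 : ‖v - ρ‖ ≤ ‖v₀ - ρ‖ := norm_le_of_norm_sub_le (by simpa using h) le_rfl
      exact (mul_le_of_le_one_left (norm_nonneg _) ht1.le).trans h3
  have hprod : ∀ m : Multiset K, (∀ ρ ∈ m, ‖t‖ * ‖v - ρ‖ ≤ ‖v₀ + t * (v - v₀) - ρ‖) →
      ‖t‖ ^ m.card * ‖(m.map (v - ·)).prod‖ ≤ ‖(m.map (v₀ + t * (v - v₀) - ·)).prod‖ := by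
    intro m
    induction m using Multiset.induction_on with
    | empty => simp
    | cons ρ m ih =>
      intro h
      have ih' := ih fun ρ' hρ' => h ρ' (by simp [hρ'])
      have h' := h ρ (by simp)
      simp only [Multiset.map_cons, Multiset.prod_cons, Multiset.card_cons, norm_mul]
      calc _ = (‖t‖ * ‖v - ρ‖) * (‖t‖ ^ m.card * ‖(m.map (v - ·)).prod‖) := by ring
        _ ≤ _ := mul_le_mul h' ih' (by positivity) (norm_nonneg _)
  have hsplit := IsAlgClosed.splits P
  rw [hsplit.eval_eq_prod_roots, hsplit.eval_eq_prod_roots, norm_mul, norm_mul]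
  calc _ = ‖P.leadingCoeff‖ * (‖t‖ ^ P.roots.card * ‖(P.roots.map (v - ·)).prod‖) := by ring
    _ ≤ _ := mul_le_mul_of_nonneg_left (hprod _ hfac) (norm_nonneg _)

lemma exists_norm_eval_eq (P : K[X]) {v₀ v₁ ω : K} (h₀ : ‖P.eval v₀‖ < ‖ω‖)
    (h₁ : ‖ω‖ ≤ ‖P.eval v₁‖) :
    ∃ v, ‖v - v₀‖ ≤ ‖v₁ - v₀‖ ∧ ‖P.eval v‖ = ‖ω‖ ∧
      ∀ w, ‖w - v₀‖ ≤ ‖v - v₀‖ → ‖P.eval w‖ ≤ ‖ω‖ := by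
  classical
  have key : ∀ u, ‖ω‖ ≤ ‖P.eval u‖ → ∃ v, ‖v - v₀‖ ≤ ‖u - v₀‖ ∧ P.eval v = ω := by
    intro u hu
    refine exists_eval_eq P ?_
    rw [norm_sub_rev, norm_sub_eq_of_lt h₀, norm_sub_rev, norm_sub_eq_of_lt (h₀.trans_le hu)]
    exact hu
  set Q := P - C ω with hQ
  have hQ0 : Q ≠ 0 := by
    intro h
    have : Q.eval v₀ = 0 := by rw [h, eval_zero]
    rw [hQ, eval_sub, eval_C, sub_eq_zero] at this
    rw [this] at h₀
    exact lt_irrefl _ h₀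
  have hmem : ∀ v, v ∈ Q.roots.toFinset ↔ P.eval v = ω := by
    intro v
    rw [Multiset.mem_toFinset, mem_roots hQ0, IsRoot, hQ, eval_sub, eval_C, sub_eq_zero]
  obtain ⟨u, hu, huω⟩ := key v₁ h₁
  obtain ⟨v, hv, hmin⟩ := Q.roots.toFinset.exists_min_image (fun v => ‖v - v₀‖)
    ⟨u, (hmem u).2 huω⟩
  have hvω := (hmem v).1 hv
  refine ⟨v, (hmin u ((hmem u).2 huω)).trans hu, by rw [hvω], fun w hw => ?_⟩
  by_contra! hlt
  have hne : w ≠ v₀ := by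
    rintro rfl
    exact lt_asymm hlt h₀
  obtain ⟨w', hw', hτ⟩ := exists_closer_norm_eval_gt P hne hlt
  obtain ⟨v', hv', hω⟩ := key w' hτ.le
  have := hmin v' ((hmem v').2 hω)
  linarith

variable {g : K → K}

lemma PolyApprox.sub {K : Type*} [NormedField K] [IsUltrametricDist K] {S : Set K} {g h : K → K}
    (hg : PolyApprox S g) (hh : PolyApprox S h) :
    PolyApprox S fun v => g v - h v := by
  intro η hη
  obtain ⟨P, hP⟩ := hg η hη
  obtain ⟨Q, hQ⟩ := hh η hη
  refine ⟨P - Q, fun v hv => ?_⟩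
  rw [eval_sub, sub_sub_sub_comm]
  exact norm_sub_lt_of_norm_lt (hP v hv) (hQ v hv)

lemma PolyApprox.exists_norm_sub_lt {v₀ v₁ w : K}
    (hg : PolyApprox (Metric.closedBall v₀ ‖v₁ - v₀‖) g) (hw : ‖w - g v₀‖ ≤ ‖g v₁ - g v₀‖)
    {η : ℝ} (hη : 0 < η) : ∃ v, ‖v - v₀‖ ≤ ‖v₁ - v₀‖ ∧ ‖g v - w‖ < η := by
  rcases lt_or_ge ‖g v₁ - g v₀‖ η with h | h
  · exact ⟨v₀, by simp, by rw [norm_sub_rev]; exact hw.trans_lt h⟩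
  obtain ⟨P, hP⟩ := hg η hη
  have hP0 := hP v₀ (by simp)
  have hP1 := hP v₁ (by simp [dist_eq_norm])
  have hdiff : ‖P.eval v₁ - P.eval v₀‖ = ‖g v₁ - g v₀‖ := by
    refine norm_eq_of_norm_sub_lt (lt_of_lt_of_le ?_ h)
    rw [sub_sub_sub_comm]
    refine norm_sub_lt_of_norm_lt ?_ ?_ <;>
      rwa [norm_sub_rev]
  obtain ⟨v, hv, hvw⟩ := exists_eval_eq P (v₀ := v₀) (v₁ := v₁) (w := w)
    (by rw [hdiff]; exact norm_sub_le_of_le hw (hP0.le.trans h))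
  refine ⟨v, hv, ?_⟩
  rw [← hvw]
  exact hP v (by simpa [dist_eq_norm] using hv)

lemma PolyApprox.exists_norm_eq {v₀ v₁ ω : K}
    (hg : PolyApprox (Metric.closedBall v₀ ‖v₁ - v₀‖) g) (h₀ : ‖g v₀‖ < ‖ω‖)
    (h₁ : ‖ω‖ ≤ ‖g v₁‖) :
    ∃ v, ‖v - v₀‖ ≤ ‖v₁ - v₀‖ ∧ ‖g v‖ = ‖ω‖ ∧
      ∀ w, ‖w - v₀‖ ≤ ‖v - v₀‖ → ‖g w‖ ≤ ‖ω‖ := by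
  obtain ⟨P, hP⟩ := hg ‖ω‖ ((norm_nonneg _).trans_lt h₀)
  have hP' : ∀ v, ‖v - v₀‖ ≤ ‖v₁ - v₀‖ → ‖g v - P.eval v‖ < ‖ω‖ :=
    fun v hv => hP v (by simpa [dist_eq_norm] using hv)
  have hP0 := hP' v₀ (by simp)
  have hP1 := hP' v₁ le_rfl
  obtain ⟨v, hv, hvω, hw⟩ := exists_norm_eval_eq P (v₀ := v₀) (v₁ := v₁) (ω := ω)
    (norm_lt_of_norm_sub_lt (by rwa [norm_sub_rev]) h₀) (by
      rw [norm_eq_of_norm_sub_lt (x := P.eval v₁) (y := g v₁)]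
      · exact h₁
      · rw [norm_sub_rev]
        exact hP1.trans_le h₁)
  refine ⟨v, hv, ?_, fun w hwv => ?_⟩
  · rw [← hvω]
    exact norm_eq_of_norm_sub_lt (by rw [hvω]; exact hP' v hv)
  · exact norm_le_of_norm_sub_le (hP' w (hwv.trans hv)).le (hw w hwv)

end Polynomial

/-- A strictly increasing sequence of radii indexed from `0`, starting above `p`. -/
structure RadiusSeq (p : ℕ) (r : ℕ → ℝ) : Prop where
  strictMono : StrictMono r
  lt_zero : (p : ℝ) < r 0
  tendsto : Tendsto r atTop atTop

/-- The maximum modulus `p t^p ∏ max (1, t / r_j)` of the entire map on the disk of radius `t`. -/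
def growth (p : ℕ) (r : ℕ → ℝ) (t : ℝ) : ℝ := p * t ^ p * ∏' j, max 1 (t / r j)

section Growth

variable {p : ℕ} {r : ℕ → ℝ}

lemma RadiusSeq.pos (hr : RadiusSeq p r) (j : ℕ) : 0 < r j :=
  (Nat.cast_nonneg p).trans_lt (hr.lt_zero.trans_le (hr.strictMono.monotone j.zero_le))

lemma RadiusSeq.exists_le (hr : RadiusSeq p r) (t : ℝ) : ∃ n, t ≤ r n :=
  (hr.tendsto.eventually_ge_atTop t).exists

lemma growth_eq (hr : RadiusSeq p r) {t : ℝ} {n : ℕ} (ht : t ≤ r n) :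
    growth p r t = p * t ^ p * ∏ j ∈ Finset.range n, max 1 (t / r j) := by
  rw [growth, tprod_eq_prod]
  intro j hj
  rw [Finset.mem_range, not_lt] at hj
  exact max_eq_left ((div_le_one (hr.pos j)).2 (ht.trans (hr.strictMono.monotone hj)))

lemma prod_max_pos (s : Finset ℕ) (t : ℝ) : 0 < ∏ j ∈ s, max 1 (t / r j) :=
  Finset.prod_pos fun _ _ => zero_lt_one.trans_le (le_max_left _ _)

lemma growth_nonneg (hr : RadiusSeq p r) {t : ℝ} (ht : 0 ≤ t) : 0 ≤ growth p r t := by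
  obtain ⟨n, hn⟩ := hr.exists_le t
  rw [growth_eq hr hn]
  have := prod_max_pos (r := r) (Finset.range n) t
  positivity

lemma growth_mono (hr : RadiusSeq p r) {s t : ℝ} (hs : 0 ≤ s) (hst : s ≤ t) :
    growth p r s ≤ growth p r t := by
  obtain ⟨n, hn⟩ := hr.exists_le t
  rw [growth_eq hr hn, growth_eq hr (hst.trans hn)]
  refine mul_le_mul (by gcongr) (Finset.prod_le_prod (fun _ _ => by positivity) fun j _ => ?_)
    (prod_max_pos _ _).le (by have := hs.trans hst; positivity)
  have := hr.pos j
  gcongr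

lemma mul_pow_le_growth (hr : RadiusSeq p r) {t : ℝ} (ht : 0 ≤ t) : p * t ^ p ≤ growth p r t := by
  obtain ⟨n, hn⟩ := hr.exists_le t
  rw [growth_eq hr hn]
  refine le_mul_of_one_le_right (by positivity) ?_
  simpa using Finset.prod_le_prod (s := Finset.range n) (f := fun _ => (1 : ℝ))
    (fun _ _ => zero_le_one) fun j _ => le_max_left 1 (t / r j)

lemma growth_strictMono (hr : RadiusSeq p r) (hp : p ≠ 0) {s t : ℝ} (hs : 0 ≤ s) (hst : s < t) :
    growth p r s < growth p r t := by
  obtain ⟨n, hn⟩ := hr.exists_le t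
  rw [growth_eq hr hn, growth_eq hr (hst.le.trans hn)]
  have hp' : (0 : ℝ) < p := by positivity
  refine mul_lt_mul (mul_lt_mul_of_pos_left (pow_lt_pow_left₀ hst hs hp) hp')
    (Finset.prod_le_prod (fun _ _ => by positivity) fun j _ => ?_)
    (prod_max_pos _ _) (by have := hs.trans hst.le; positivity)
  have := hr.pos j
  gcongr

lemma growth_eq_of_le (hr : RadiusSeq p r) {t : ℝ} (ht : t ≤ r 0) :
    growth p r t = p * t ^ p := by
  simp [growth_eq hr ht]

lemma growth_iterate_nonneg (hr : RadiusSeq p r) {t : ℝ} (ht : 0 ≤ t) (n : ℕ) :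
    0 ≤ (growth p r)^[n] t := by
  induction n with
  | zero => simpa
  | succ n ih =>
    rw [Function.iterate_succ_apply']
    exact growth_nonneg hr ih

lemma growth_iterate_mono (hr : RadiusSeq p r) {s t : ℝ} (hs : 0 ≤ s) (hst : s ≤ t) (n : ℕ) :
    (growth p r)^[n] s ≤ (growth p r)^[n] t := by
  induction n with
  | zero => simpa
  | succ n ih =>
    rw [Function.iterate_succ_apply', Function.iterate_succ_apply']
    exact growth_mono hr (growth_iterate_nonneg hr hs n) ih

lemma growth_iterate_strictMono (hr : RadiusSeq p r) (hp : p ≠ 0) {s t : ℝ} (hs : 0 ≤ s)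
    (hst : s < t) (n : ℕ) : (growth p r)^[n] s < (growth p r)^[n] t := by
  induction n with
  | zero => simpa
  | succ n ih =>
    rw [Function.iterate_succ_apply', Function.iterate_succ_apply']
    exact growth_strictMono hr hp (growth_iterate_nonneg hr hs n) ih

lemma rho_pos [Fact p.Prime] : 0 < rho p :=
  Real.rpow_pos_of_pos (by exact_mod_cast (Fact.out : p.Prime).pos) _

lemma rho_pow_pred [hp : Fact p.Prime] : rho p ^ (p - 1) = (p : ℝ)⁻¹ := by
  have h1 : (1 : ℝ) < p := by exact_mod_cast hp.out.one_lt
  rw [rho, ← Real.rpow_natCast, ← Real.rpow_mul (by positivity), Nat.cast_sub hp.out.one_le,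
    Nat.cast_one, div_mul_cancel₀ _ (by linarith), Real.rpow_neg_one]

lemma rho_lt_one [hp : Fact p.Prime] : rho p < 1 := by
  have h1 : (1 : ℝ) < p := by exact_mod_cast hp.out.one_lt
  by_contra! h
  have := one_le_pow₀ (n := p - 1) h
  rw [rho_pow_pred] at this
  exact absurd (inv_lt_one_of_one_lt₀ h1) (not_lt.2 this)

lemma lt_growth [hp : Fact p.Prime] (hr : RadiusSeq p r) {t : ℝ} (ht : rho p < t) :
    t < growth p r t := by
  have h0 : (0 : ℝ) < p := by exact_mod_cast hp.out.pos
  have ht0 : 0 < t := rho_pos.trans ht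
  refine lt_of_lt_of_le ?_ (mul_pow_le_growth hr ht0.le)
  have h : (p : ℝ)⁻¹ < t ^ (p - 1) := by
    rw [← rho_pow_pred]
    exact pow_lt_pow_left₀ ht rho_pos.le (Nat.sub_ne_zero_of_lt hp.out.one_lt)
  calc t = p * ((p : ℝ)⁻¹ * t) := by field_simp
    _ < p * (t ^ (p - 1) * t) := by gcongr
    _ = p * t ^ p := by rw [← pow_succ, Nat.sub_add_cancel hp.out.one_le]

lemma growth_rho [hp : Fact p.Prime] (hr : RadiusSeq p r) : growth p r (rho p) = rho p := by
  have h1 : (1 : ℝ) < p := by exact_mod_cast hp.out.one_lt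
  rw [growth_eq_of_le hr (rho_lt_one.le.trans (h1.trans hr.lt_zero).le)]
  rw [← Nat.sub_add_cancel hp.out.one_le, pow_succ, Nat.sub_add_cancel hp.out.one_le,
    rho_pow_pred]
  field_simp

lemma exists_growth_eq [hp : Fact p.Prime] (hr : RadiusSeq p r) {s : ℝ} (hs : rho p < s) :
    ∃ t, rho p < t ∧ growth p r t = s := by
  obtain ⟨n, hn⟩ := hr.exists_le s
  have hcont : ContinuousOn (growth p r) (Set.Icc (rho p) s) := by
    refine ContinuousOn.congr (f := fun t => p * t ^ p * ∏ j ∈ Finset.range n, max 1 (t / r j))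
      (Continuous.continuousOn (by fun_prop)) fun t ht => growth_eq hr (ht.2.trans hn)
  obtain ⟨t, ht, hts⟩ := intermediate_value_Icc hs.le hcont
    ⟨(growth_rho hr).le.trans hs.le, (lt_growth hr hs).le⟩
  refine ⟨t, lt_of_le_of_ne ht.1 ?_, hts⟩
  rintro rfl
  rw [growth_rho hr] at hts
  exact hs.ne hts

lemma exists_growth_iterate_eq [Fact p.Prime] (hr : RadiusSeq p r) {s : ℝ} (hs : rho p < s)
    (q : ℕ) : ∃ t, rho p < t ∧ (growth p r)^[q] t = s := by
  induction q with
  | zero => exact ⟨s, hs, rfl⟩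
  | succ q ih =>
    obtain ⟨t, ht, hts⟩ := ih
    obtain ⟨u, hu, hut⟩ := exists_growth_eq hr ht
    exact ⟨u, hu, by rw [Function.iterate_succ_apply, hut, hts]⟩

lemma rho_lt_growth_iterate [Fact p.Prime] (hr : RadiusSeq p r) {t : ℝ} (ht : rho p < t) (n : ℕ) :
    rho p < (growth p r)^[n] t := by
  induction n with
  | zero => exact ht
  | succ n ih =>
    rw [Function.iterate_succ_apply']
    exact ih.trans (lt_growth hr ih)

lemma growth_iterate_strictMono_index [Fact p.Prime] (hr : RadiusSeq p r) {t : ℝ}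
    (ht : rho p < t) : StrictMono fun n => (growth p r)^[n] t :=
  strictMono_nat_of_lt_succ fun n => by
    rw [Function.iterate_succ_apply']
    exact lt_growth hr (rho_lt_growth_iterate hr ht n)

lemma exists_lt_growth_iterate_one [hp : Fact p.Prime] (hr : RadiusSeq p r) (B : ℝ) :
    ∃ n, B < (growth p r)^[n] 1 := by
  have h1 : (1 : ℝ) < p := by exact_mod_cast hp.out.one_lt
  have h : ∀ n, (p : ℝ) ^ n ≤ (growth p r)^[n] 1 := by
    intro n
    induction n with
    | zero => simp
    | succ n ih =>
      rw [Function.iterate_succ_apply', pow_succ']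
      have h1' : (1 : ℝ) ≤ (growth p r)^[n] 1 := (one_le_pow₀ h1.le).trans ih
      calc (p : ℝ) * p ^ n ≤ p * (growth p r)^[n] 1 := by gcongr
        _ ≤ p * ((growth p r)^[n] 1) ^ p := by
          gcongr
          exact le_self_pow₀ h1' hp.out.ne_zero
        _ ≤ _ := mul_pow_le_growth hr (zero_le_one.trans h1')
  obtain ⟨n, hn⟩ := pow_unbounded_of_one_lt B h1
  exact ⟨n, hn.trans_le (h n)⟩

end Growth

/-- The entire map `z ^ p / p * ∏ (1 - e_j z)`. -/
def entireMap (p : ℕ) {K : Type*} [NormedField K] (e : ℕ → K) (z : K) : K :=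
  z ^ p / (p : K) * ∏' j, (1 - e j * z)

section EntireMap

variable {p : ℕ} {r : ℕ → ℝ} {K : Type*} [NormedField K] [IsUltrametricDist K]

lemma norm_one_sub_mul_le (hr : RadiusSeq p r) {e : ℕ → K} (he : ∀ j, ‖e j‖ ≤ (r j)⁻¹)
    {z : K} {T : ℝ} (hz : ‖z‖ ≤ T) (j : ℕ) : ‖1 - e j * z‖ ≤ max 1 (T / r j) := by
  have h : ‖e j * z‖ ≤ T / r j := by
    rw [norm_mul, div_eq_inv_mul]
    exact mul_le_mul (he j) hz (norm_nonneg _) (inv_nonneg.2 (hr.pos j).le)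
  refine norm_le_of_norm_sub_le (y := 1) ?_ (by simp)
  simpa using Or.inr h

lemma multipliable_one_sub_mul [CompleteSpace K] (hr : RadiusSeq p r) {e : ℕ → K}
    (he : ∀ j, ‖e j‖ ≤ (r j)⁻¹) (z : K) : Multipliable fun j => 1 - e j * z := by
  classical
  rw [multipliable_iff_cauchySeq_finset, Metric.cauchySeq_iff']
  intro ε hε
  obtain ⟨J, hJ⟩ := hr.exists_le ‖z‖
  set C := ∏ j ∈ Finset.range J, max 1 (‖z‖ / r j) with hC
  have hlim : Tendsto (fun n => ‖z‖ / r n * C) atTop (𝓝 (0 * C)) :=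
    (hr.tendsto.const_div_atTop _).mul_const _
  rw [zero_mul] at hlim
  obtain ⟨n, hnε, hnJ⟩ :=
    ((hlim.eventually_lt_const hε).and (eventually_ge_atTop J)).exists
  refine ⟨Finset.range n, fun s hs => ?_⟩
  have hs' : Finset.range n ⊆ s := hs
  have hb : ∏ j ∈ s, (if j ∈ Finset.range n then 1 - e j * z else 1)
      = ∏ j ∈ Finset.range n, (1 - e j * z) := by
    rw [Finset.prod_ite_mem, Finset.inter_eq_right.2 hs']
  have hA : ∏ j ∈ s, max 1 (‖z‖ / r j) = C := by
    refine (Finset.prod_subset ((Finset.range_mono hnJ).trans hs') fun j _ hj => ?_).symm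
    rw [Finset.mem_range, not_lt] at hj
    exact max_eq_left ((div_le_one (hr.pos j)).2 (hJ.trans (hr.strictMono.monotone hj)))
  rw [dist_eq_norm, ← hb]
  refine lt_of_le_of_lt ?_ hnε
  rw [← hA]
  have hpos : ∀ j, 0 ≤ ‖z‖ / r j := fun j => div_nonneg (norm_nonneg _) (hr.pos j).le
  refine norm_prod_sub_prod_le s (hpos n) (fun j _ => norm_one_sub_mul_le hr he le_rfl j)
    (fun j _ => ?_) (fun j _ => ?_)
  · split_ifs
    · exact norm_one_sub_mul_le hr he le_rfl j
    · simp
  · split_ifs with h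
    · rw [sub_self, norm_zero]
      exact mul_nonneg (hpos n) (by positivity)
    · rw [Finset.mem_range, not_lt] at h
      calc ‖1 - e j * z - 1‖ = ‖e j‖ * ‖z‖ := by simp
        _ ≤ (r n)⁻¹ * ‖z‖ := by
          gcongr
          refine (he j).trans ?_
          have := hr.pos n
          have := hr.strictMono.monotone h
          gcongr
        _ = ‖z‖ / r n * 1 := by ring
        _ ≤ _ := mul_le_mul_of_nonneg_left (le_max_left _ _) (hpos n)

lemma tendsto_entireMap [CompleteSpace K] (hr : RadiusSeq p r) {e : ℕ → K}
    (he : ∀ j, ‖e j‖ ≤ (r j)⁻¹) (z : K) :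
    Tendsto (fun n => z ^ p / (p : K) * ∏ j ∈ Finset.range n, (1 - e j * z)) atTop
      (𝓝 (entireMap p e z)) :=
  (multipliable_one_sub_mul hr he z).hasProd.tendsto_prod_nat.const_mul _

lemma tendsto_growth (hr : RadiusSeq p r) (t : ℝ) :
    Tendsto (fun n => p * t ^ p * ∏ j ∈ Finset.range n, max 1 (t / r j)) atTop
      (𝓝 (growth p r t)) := by
  refine tendsto_const_nhds.congr' ?_
  filter_upwards [hr.tendsto.eventually_ge_atTop t] with n hn using growth_eq hr hn

lemma norm_pow_div {K : Type*} [NormedField K] (hpK : ‖(p : K)‖ = (p : ℝ)⁻¹) (z : K) :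
    ‖z ^ p / (p : K)‖ = p * ‖z‖ ^ p := by
  rw [norm_div, norm_pow, hpK, div_inv_eq_mul, mul_comm]

lemma norm_entireMap_eq [CompleteSpace K] (hr : RadiusSeq p r) (hpK : ‖(p : K)‖ = (p : ℝ)⁻¹)
    {e : ℕ → K} (he : ∀ j, ‖e j‖ ≤ (r j)⁻¹) {z : K}
    (h : ∀ j, ‖1 - e j * z‖ = max 1 (‖z‖ / r j)) : ‖entireMap p e z‖ = growth p r ‖z‖ := by
  refine tendsto_nhds_unique (tendsto_entireMap hr he z).norm
    ((tendsto_growth hr ‖z‖).congr fun n => ?_)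
  rw [norm_mul, norm_pow_div hpK, norm_prod]
  simp_rw [h]

lemma norm_entireMap_le [CompleteSpace K] (hr : RadiusSeq p r) (hpK : ‖(p : K)‖ = (p : ℝ)⁻¹)
    {e : ℕ → K} (he : ∀ j, ‖e j‖ ≤ (r j)⁻¹) {z : K} {T : ℝ} (hz : ‖z‖ ≤ T) :
    ‖entireMap p e z‖ ≤ growth p r T := by
  refine le_of_tendsto_of_tendsto' (tendsto_entireMap hr he z).norm (tendsto_growth hr T)
    fun n => ?_
  rw [norm_mul, norm_pow_div hpK, norm_prod]
  have := (norm_nonneg z).trans hz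
  exact mul_le_mul (by gcongr) (Finset.prod_le_prod (fun _ _ => norm_nonneg _)
    fun j _ => norm_one_sub_mul_le hr he hz j) (by positivity) (by positivity)

lemma norm_iterate_entireMap_le [CompleteSpace K] (hr : RadiusSeq p r)
    (hpK : ‖(p : K)‖ = (p : ℝ)⁻¹) {e : ℕ → K} (he : ∀ j, ‖e j‖ ≤ (r j)⁻¹) {z : K} {T : ℝ}
    (hz : ‖z‖ ≤ T) (n : ℕ) : ‖(entireMap p e)^[n] z‖ ≤ (growth p r)^[n] T := by
  induction n with
  | zero => simpa
  | succ n ih =>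
    rw [Function.iterate_succ_apply', Function.iterate_succ_apply']
    exact norm_entireMap_le hr hpK he ih

/-- Variation of the entire map under a simultaneous change of coefficients and argument. -/
lemma norm_entireMap_sub_le [CompleteSpace K] (hr : RadiusSeq p r)
    (hpK : ‖(p : K)‖ = (p : ℝ)⁻¹) {e e' : ℕ → K} (he : ∀ j, ‖e j‖ ≤ (r j)⁻¹)
    (he' : ∀ j, ‖e' j‖ ≤ (r j)⁻¹) {z z' : K} {T θ : ℝ} (hθ : 0 ≤ θ) (hz : ‖z‖ ≤ T)
    (hz' : ‖z'‖ ≤ T) (hpow : ‖z ^ p - z' ^ p‖ ≤ θ * T ^ p)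
    (hmul : ∀ j, ‖e j * z - e' j * z'‖ ≤ θ * max 1 (T / r j)) :
    ‖entireMap p e z - entireMap p e' z'‖ ≤ θ * growth p r T := by
  refine le_of_tendsto_of_tendsto'
    ((tendsto_entireMap hr he z).sub (tendsto_entireMap hr he' z')).norm
    ((tendsto_growth hr T).const_mul θ) fun n => ?_
  have hT := (norm_nonneg z).trans hz
  have h1 := norm_prod_sub_prod_le (Finset.range n) (a := fun j => 1 - e j * z)
    (b := fun j => 1 - e' j * z') (A := fun j => max 1 (T / r j)) hθ
    (fun j _ => norm_one_sub_mul_le hr he hz j) (fun j _ => norm_one_sub_mul_le hr he' hz' j)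
    (fun j _ => by
      rw [sub_sub_sub_cancel_left, norm_sub_rev]
      exact hmul j)
  have hA := prod_max_pos (r := r) (Finset.range n) T
  have h2 : ‖∏ j ∈ Finset.range n, (1 - e' j * z')‖ ≤ ∏ j ∈ Finset.range n, max 1 (T / r j) := by
    rw [norm_prod]
    exact Finset.prod_le_prod (fun _ _ => norm_nonneg _)
      fun j _ => norm_one_sub_mul_le hr he' hz' j
  have h3 : ‖z ^ p / (p : K) - z' ^ p / (p : K)‖ ≤ θ * (p * T ^ p) := by
    rw [← sub_div, norm_div, hpK, div_inv_eq_mul]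
    calc _ ≤ θ * T ^ p * p := by gcongr
      _ = _ := by ring
  refine norm_sub_le_of_le
    (y := z ^ p / (p : K) * ∏ j ∈ Finset.range n, (1 - e' j * z')) ?_ ?_
  · rw [← mul_sub, norm_mul, norm_pow_div hpK]
    calc _ ≤ (p * T ^ p) * (θ * ∏ j ∈ Finset.range n, max 1 (T / r j)) := by gcongr
      _ = _ := by ring
  · rw [← sub_mul, norm_mul]
    calc _ ≤ (θ * (p * T ^ p)) * ∏ j ∈ Finset.range n, max 1 (T / r j) :=
          mul_le_mul h3 h2 (norm_nonneg _) (by positivity)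
      _ = _ := by ring

lemma norm_mul_sub_mul_le {a a' z z' : K} {ρ T d : ℝ} (ha : ‖a‖ ≤ ρ)
    (hz' : ‖z'‖ ≤ T) (hd : ‖a - a'‖ ≤ d) : ‖a * z - a' * z'‖ ≤ max (ρ * ‖z - z'‖) (T * d) := by
  refine norm_sub_le_of_le (y := a * z') (le_max_of_le_left ?_) (le_max_of_le_right ?_)
  · rw [← mul_sub, norm_mul]
    gcongr
  · rw [← sub_mul, norm_mul, mul_comm]
    exact mul_le_mul hz' hd (norm_nonneg _) ((norm_nonneg _).trans hz')

lemma norm_entireMap_sub_le_max [CompleteSpace K] (hr : RadiusSeq p r)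
    (hpK : ‖(p : K)‖ = (p : ℝ)⁻¹) {e e' : ℕ → K} (he : ∀ j, ‖e j‖ ≤ (r j)⁻¹)
    (he' : ∀ j, ‖e' j‖ ≤ (r j)⁻¹) {z z' : K} {T d : ℝ} (hT : 0 < T) (hz : ‖z‖ ≤ T)
    (hz' : ‖z'‖ ≤ T) (hd : ∀ j, ‖e j - e' j‖ ≤ d) :
    ‖entireMap p e z - entireMap p e' z'‖ ≤ max (‖z - z'‖ / T) (T * d) * growth p r T := by
  have hθ : 0 ≤ max (‖z - z'‖ / T) (T * d) := le_max_of_le_left (by positivity)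
  refine norm_entireMap_sub_le hr hpK he he' hθ hz hz' ?_ fun j => ?_
  · refine norm_pow_sub_pow_le hθ hz hz' ?_ p
    rw [← div_le_iff₀ hT]
    exact le_max_left _ _
  · have hj := hr.pos j
    refine (norm_mul_sub_mul_le (he j) hz' (hd j)).trans (max_le ?_ ?_)
    · calc (r j)⁻¹ * ‖z - z'‖ = ‖z - z'‖ / T * (T / r j) := by field_simp
        _ ≤ _ := mul_le_mul (le_max_left _ _) (le_max_right _ _) (by positivity) hθ
    · calc T * d = T * d * 1 := by ring
        _ ≤ _ := mul_le_mul (le_max_right _ _) (le_max_left _ _) zero_le_one hθ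

lemma norm_add_pow_prime_sub_le [hp : Fact p.Prime] (hpK : ‖(p : K)‖ = (p : ℝ)⁻¹) {z z' : K}
    {T h : ℝ} (hT : 0 < T) (hz' : ‖z'‖ ≤ T) (hh : ‖z - z'‖ ≤ h * T) (hρ : h ≤ rho p) :
    ‖z ^ p - z' ^ p‖ ≤ h / p * T ^ p := by
  have hp0 : (0 : ℝ) < p := by exact_mod_cast hp.out.pos
  have h0 : 0 ≤ h := nonneg_of_mul_nonneg_left ((norm_nonneg _).trans hh) hT
  have hwT : ‖z - z'‖ ≤ T :=
    hh.trans (mul_le_of_le_one_left hT.le (hρ.trans rho_lt_one.le))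
  obtain ⟨w, rfl⟩ : ∃ w, z = z' + w := ⟨z - z', by ring⟩
  rw [add_sub_cancel_left] at hh hwT
  rw [add_pow_prime_eq hp.out, add_assoc, add_sub_cancel_left]
  refine (IsUltrametricDist.norm_add_le_max _ _).trans (max_le ?_ ?_)
  · rw [norm_pow]
    calc ‖w‖ ^ p ≤ (h * T) ^ p := by gcongr
      _ = h ^ (p - 1) * h * T ^ p := by
        rw [mul_pow, ← pow_succ, Nat.sub_add_cancel hp.out.one_le]
      _ ≤ rho p ^ (p - 1) * h * T ^ p := by gcongr
      _ = _ := by rw [rho_pow_pred]; ring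
  · have hsum : ‖∑ k ∈ Finset.Ioo 0 p, z' ^ (k - 1) * w ^ (p - k - 1) * ((p.choose k / p : ℕ) : K)‖
        ≤ T ^ (p - 2) := by
      refine IsUltrametricDist.norm_sum_le_of_forall_le_of_nonneg (by positivity) fun k hk => ?_
      rw [Finset.mem_Ioo] at hk
      rw [norm_mul, norm_mul, norm_pow, norm_pow]
      calc _ ≤ T ^ (k - 1) * T ^ (p - k - 1) * 1 := by
            gcongr
            exact IsUltrametricDist.norm_natCast_le_one K _
        _ = T ^ (p - 2) := by
          rw [mul_one, ← pow_add]
          congr 1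
          omega
    rw [norm_mul, norm_mul, norm_mul, hpK]
    calc _ ≤ (p : ℝ)⁻¹ * T * (h * T) * T ^ (p - 2) := by gcongr
      _ = h / p * T ^ (p - 2 + 2) := by ring
      _ = _ := by rw [Nat.sub_add_cancel hp.out.two_le]

/-- Inside the unit disk, relative distances below `ϱ` shrink by the factor `p`. -/
lemma norm_entireMap_sub_le_of_le_one [CompleteSpace K] [hp : Fact p.Prime] (hr : RadiusSeq p r)
    (hpK : ‖(p : K)‖ = (p : ℝ)⁻¹) {e e' : ℕ → K} (he : ∀ j, ‖e j‖ ≤ (r j)⁻¹)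
    (he' : ∀ j, ‖e' j‖ ≤ (r j)⁻¹) {z z' : K} {T d h : ℝ} (hT : 0 < T) (hT1 : T ≤ 1)
    (hz : ‖z‖ ≤ T) (hz' : ‖z'‖ ≤ T) (hd : ∀ j, ‖e j - e' j‖ ≤ d) (hh : ‖z - z'‖ ≤ h * T)
    (hρ : h ≤ rho p) :
    ‖entireMap p e z - entireMap p e' z'‖ ≤ max (h / p) (T * d) * growth p r T := by
  have hp0 : (0 : ℝ) < p := by exact_mod_cast hp.out.pos
  have h0 : 0 ≤ h := nonneg_of_mul_nonneg_left ((norm_nonneg _).trans hh) hT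
  have hθ : 0 ≤ max (h / p) (T * d) := le_max_of_le_left (by positivity)
  refine norm_entireMap_sub_le hr hpK he he' hθ hz hz' ?_ fun j => ?_
  · refine (norm_add_pow_prime_sub_le hpK hT hz' hh hρ).trans ?_
    gcongr
    exact le_max_left _ _
  · have hj : (p : ℝ) < r j := hr.lt_zero.trans_le (hr.strictMono.monotone j.zero_le)
    refine ((norm_mul_sub_mul_le (he j) hz' (hd j)).trans ?_).trans
      (le_mul_of_one_le_right hθ (le_max_left _ _))
    refine max_le_max ?_ le_rfl
    calc (r j)⁻¹ * ‖z - z'‖ ≤ (p : ℝ)⁻¹ * (h * 1) := by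
          gcongr
          exact hh.trans (by gcongr)
      _ = h / p := by ring

lemma entireMap_eq_mul_update [CompleteSpace K] (hr : RadiusSeq p r) {e : ℕ → K}
    (he : ∀ j, ‖e j‖ ≤ (r j)⁻¹) (k : ℕ) (z : K) :
    entireMap p e z = (1 - e k * z) * entireMap p (Function.update e k 0) z := by
  have he' : ∀ j, ‖Function.update e k 0 j‖ ≤ (r j)⁻¹ := by
    intro j
    rcases eq_or_ne j k with rfl | h
    · simpa using (hr.pos j).le
    · simpa [h] using he j
  refine tendsto_nhds_unique (tendsto_entireMap hr he z)
    (((tendsto_entireMap hr he' z).const_mul (1 - e k * z)).congr' ?_)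
  filter_upwards [eventually_gt_atTop k] with n hn
  have hk : k ∈ Finset.range n := Finset.mem_range.2 hn
  rw [← Finset.mul_prod_erase _ _ hk, ← Finset.mul_prod_erase _ (fun j => 1 - e j * z) hk]
  have : ∏ j ∈ (Finset.range n).erase k, (1 - Function.update e k 0 j * z)
      = ∏ j ∈ (Finset.range n).erase k, (1 - e j * z) :=
    Finset.prod_congr rfl fun j hj => by simp [(Finset.mem_erase.1 hj).1]
  rw [this]
  simp
  ring

end EntireMap

section Dynamics

variable {p : ℕ} {r : ℕ → ℝ} {K : Type*} [NontriviallyNormedField K]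

lemma norm_update_le {e : ℕ → K} (he : ∀ j, ‖e j‖ ≤ (r j)⁻¹) {k : ℕ} {v : K}
    (hv : ‖v‖ ≤ (r k)⁻¹) (j : ℕ) : ‖Function.update e k v j‖ ≤ (r j)⁻¹ := by
  rcases eq_or_ne j k with rfl | h
  · simpa using hv
  · simpa [h] using he j

lemma norm_eq_of_norm_one_sub_mul_lt [IsUltrametricDist K] {a z : K}
    {s : ℝ} (hs : 0 < s) (ha : ‖a‖ = s⁻¹) (h : ‖1 - a * z‖ < 1) : ‖z‖ = s := by
  have h1 : ‖a * z‖ = 1 := by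
    rw [← norm_one (α := K)]
    exact norm_eq_of_norm_sub_lt (by rwa [norm_sub_rev, norm_one])
  rw [norm_mul, ha, inv_mul_eq_one₀ hs.ne'] at h1
  exact h1.symm

lemma exists_norm_eq_of_growth_eq [hp : Fact p.Prime] [IsAlgClosed K]
    (hr : RadiusSeq p r) (hpK : ‖(p : K)‖ = (p : ℝ)⁻¹) {e : ℕ → K}
    (he : ∀ j, ‖e j‖ = (r j)⁻¹) {t : ℝ} (ht : 0 < t) {a : K} (ha : ‖a‖ = growth p r t) :
    ∃ b : K, ‖b‖ = t := by
  have hp0 : (0 : ℝ) < p := by exact_mod_cast hp.out.pos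
  have key : ∀ n, ∃ (d : ℕ) (γ : K), γ ≠ 0 ∧
      ∏ j ∈ Finset.range n, max 1 (t / r j) = t ^ d * ‖γ‖ := by
    intro n
    induction n with
    | zero => exact ⟨0, 1, one_ne_zero, by simp⟩
    | succ n ih =>
      obtain ⟨d, γ, hγ, h⟩ := ih
      rw [Finset.prod_range_succ, h]
      rcases le_total (t / r n) 1 with h1 | h1
      · exact ⟨d, γ, hγ, by rw [max_eq_left h1, mul_one]⟩
      · refine ⟨d + 1, γ * e n, mul_ne_zero hγ ?_, ?_⟩
        · rw [← norm_pos_iff, he]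
          exact inv_pos.2 (hr.pos n)
        · rw [max_eq_right h1, norm_mul, he]
          ring
  obtain ⟨n, hn⟩ := hr.exists_le t
  obtain ⟨d, γ, hγ, h⟩ := key n
  rw [growth_eq hr hn, h] at ha
  have hd : p + d ≠ 0 := by have := hp.out.pos; omega
  obtain ⟨b, hb⟩ := IsAlgClosed.exists_pow_nat_eq (a * (p : K) / γ) (Nat.pos_of_ne_zero hd)
  refine ⟨b, (pow_left_inj₀ (norm_nonneg b) ht.le hd).1 ?_⟩
  have hγ' : 0 < ‖γ‖ := norm_pos_iff.2 hγ
  rw [← norm_pow, hb, norm_div, norm_mul, ha, hpK, pow_add]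
  field_simp

lemma exists_norm_eq_of_growth_iterate_eq [Fact p.Prime] [IsAlgClosed K] (hr : RadiusSeq p r)
    (hpK : ‖(p : K)‖ = (p : ℝ)⁻¹) {e : ℕ → K} (he : ∀ j, ‖e j‖ = (r j)⁻¹) {t : ℝ}
    (ht : rho p < t) (q : ℕ) {a : K} (ha : ‖a‖ = (growth p r)^[q] t) : ∃ b : K, ‖b‖ = t := by
  induction q generalizing a with
  | zero => exact ⟨a, ha⟩
  | succ q ih =>
    rw [Function.iterate_succ_apply'] at ha
    obtain ⟨b, hb⟩ := exists_norm_eq_of_growth_eq hr hpK he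
      (rho_pos.trans (rho_lt_growth_iterate hr ht q)) ha
    exact ih hb

variable [IsUltrametricDist K] [CompleteSpace K]

lemma PolyApprox.entireMap (hr : RadiusSeq p r) (hpK : ‖(p : K)‖ = (p : ℝ)⁻¹) {S : Set K}
    {g : K → K} (hg : PolyApprox S g) {T : ℝ} (hT : 0 < T) (hgT : ∀ v ∈ S, ‖g v‖ ≤ T)
    {E : ℕ → K[X]} (hE : ∀ v ∈ S, ∀ j, ‖(E j).eval v‖ ≤ (r j)⁻¹) :
    PolyApprox S fun v => entireMap p (fun j => (E j).eval v) (g v) := by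
  intro η hη
  have hG : 0 ≤ growth p r T := growth_nonneg hr hT.le
  set A := η / (growth p r T + 1) with hA
  have hA0 : 0 < A := by positivity
  obtain ⟨P, hP⟩ := hg (min T (A * T)) (by positivity)
  obtain ⟨n, hn⟩ := ((hr.tendsto.const_div_atTop T).eventually_lt_const hA0).exists
  refine ⟨C (p : K)⁻¹ * P ^ p * ∏ j ∈ Finset.range n, (1 - E j * P), fun v hv => ?_⟩
  set e' : ℕ → K := fun j => if j ∈ Finset.range n then (E j).eval v else 0 with he'
  have hrn := hr.pos n
  have heq : (C (p : K)⁻¹ * P ^ p * ∏ j ∈ Finset.range n, (1 - E j * P)).eval v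
      = OscillatingMap.entireMap p e' (P.eval v) := by
    rw [OscillatingMap.entireMap, tprod_eq_prod (s := Finset.range n)
      (fun j hj => by simp only [he', if_neg hj, zero_mul, sub_zero])]
    rw [Finset.prod_congr rfl (g := fun j => 1 - (E j).eval v * P.eval v)
      (fun j hj => by simp only [he', if_pos hj])]
    simp only [eval_mul, eval_C, eval_pow, eval_prod, eval_sub, eval_one]
    ring
  have hPT : ‖P.eval v‖ ≤ T := by
    refine norm_le_of_norm_sub_le (y := g v) ?_ (hgT v hv)
    rw [norm_sub_rev]
    exact ((hP v hv).trans_le (min_le_left _ _)).le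
  rw [heq]
  refine (norm_entireMap_sub_le_max (d := (r n)⁻¹) hr hpK (hE v hv) ?_ hT (hgT v hv) hPT
    ?_).trans_lt ?_
  · intro j
    simp only [he']
    split_ifs
    · exact hE v hv j
    · simpa using (hr.pos j).le
  · intro j
    simp only [he']
    split_ifs with h
    · simpa using hrn.le
    · rw [Finset.mem_range, not_lt] at h
      rw [sub_zero]
      refine (hE v hv j).trans ?_
      have := hr.strictMono.monotone h
      gcongr
  · calc _ ≤ A * growth p r T := by
          gcongr
          refine max_le ?_ ?_
          · rw [div_le_iff₀ hT]
            exact ((hP v hv).trans_le (min_le_right _ _)).le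
          · rw [← div_eq_mul_inv]
            exact hn.le
      _ < A * (growth p r T + 1) := by
          gcongr
          exact lt_add_one _
      _ = η := by rw [hA]; field_simp

lemma norm_entireMap_eq_growth (hr : RadiusSeq p r) (hpK : ‖(p : K)‖ = (p : ℝ)⁻¹) {e : ℕ → K}
    (he : ∀ j, ‖e j‖ = (r j)⁻¹) {z : K} (hz : ∀ j, ‖z‖ ≠ r j) :
    ‖entireMap p e z‖ = growth p r ‖z‖ := by
  refine norm_entireMap_eq hr hpK (fun j => (he j).le) fun j => ?_
  have hj := hr.pos j
  have h : ‖e j * z‖ = ‖z‖ / r j := by rw [norm_mul, he, div_eq_inv_mul]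
  rcases lt_or_gt_of_ne (hz j) with hlt | hlt
  · have h1 : ‖z‖ / r j < 1 := (div_lt_one hj).2 hlt
    rw [max_eq_left h1.le, norm_sub_rev, norm_sub_eq_of_lt (by simpa [he, h] using h1), norm_one]
  · have h1 : 1 < ‖z‖ / r j := (one_lt_div hj).2 hlt
    rw [max_eq_right h1.le, norm_sub_eq_of_lt (by rwa [norm_one, h]), h]

lemma norm_iterate_entireMap_eq (hr : RadiusSeq p r) (hpK : ‖(p : K)‖ = (p : ℝ)⁻¹) {e : ℕ → K}
    (he : ∀ j, ‖e j‖ = (r j)⁻¹) {z : K} (n : ℕ)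
    (hz : ∀ i < n, ∀ j, (growth p r)^[i] ‖z‖ ≠ r j) :
    ‖(entireMap p e)^[n] z‖ = (growth p r)^[n] ‖z‖ := by
  induction n with
  | zero => rfl
  | succ n ih =>
    have h := ih fun i hi => hz i (hi.trans n.lt_succ_self)
    rw [Function.iterate_succ_apply', Function.iterate_succ_apply',
      norm_entireMap_eq_growth hr hpK he (by rw [h]; exact hz n n.lt_succ_self), h]

lemma norm_entireMap_update_zero (hr : RadiusSeq p r) (hpK : ‖(p : K)‖ = (p : ℝ)⁻¹) {e : ℕ → K}
    (he : ∀ j, ‖e j‖ = (r j)⁻¹) {k : ℕ} {z : K} (hz : ‖z‖ = r k) :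
    ‖entireMap p (Function.update e k 0) z‖ = growth p r (r k) := by
  rw [← hz]
  refine norm_entireMap_eq hr hpK
    (norm_update_le (fun j => (he j).le) (by simpa using (hr.pos k).le)) fun j => ?_
  have hj := hr.pos j
  have h : ‖e j * z‖ = r k / r j := by rw [norm_mul, he, hz, div_eq_inv_mul]
  rw [hz]
  rcases lt_trichotomy k j with hkj | rfl | hkj
  · have h1 : r k / r j < 1 := (div_lt_one hj).2 (hr.strictMono hkj)
    rw [Function.update_of_ne hkj.ne', max_eq_left h1.le, norm_sub_rev,
      norm_sub_eq_of_lt (by simpa [he, h] using h1), norm_one]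
  · simp [hj.ne']
  · have h1 : 1 < r k / r j := (one_lt_div hj).2 (hr.strictMono hkj)
    rw [Function.update_of_ne hkj.ne, max_eq_right h1.le,
      norm_sub_eq_of_lt (by rwa [norm_one, h]), h]

lemma norm_entireMap_update_sub (hr : RadiusSeq p r) (hpK : ‖(p : K)‖ = (p : ℝ)⁻¹) {e : ℕ → K}
    (he : ∀ j, ‖e j‖ = (r j)⁻¹) {k : ℕ} {v z : K} (hv : ‖v‖ = (r k)⁻¹) (hz : ‖z‖ = r k) :
    ‖entireMap p (Function.update e k v) z - entireMap p e z‖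
      = growth p r (r k) * r k * ‖v - e k‖ := by
  rw [entireMap_eq_mul_update hr (fun j => (he j).le) k z,
    entireMap_eq_mul_update hr (norm_update_le (fun j => (he j).le) hv.le) k z,
    Function.update_idem, Function.update_self, ← sub_mul, sub_sub_sub_cancel_left, ← sub_mul,
    norm_mul, norm_mul, hz, norm_entireMap_update_zero hr hpK he hz, norm_sub_rev]
  ring

variable [hp : Fact p.Prime]

/-- Iterates of a fixed order depend uniformly continuously on the coefficients. -/
lemma exists_forall_norm_iterate_sub_lt (hr : RadiusSeq p r) (hpK : ‖(p : K)‖ = (p : ℝ)⁻¹)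
    (n : ℕ) {η : ℝ} (hη : 0 < η) : ∃ d > 0, ∀ e e' : ℕ → K, (∀ j, ‖e j‖ ≤ (r j)⁻¹) →
      (∀ j, ‖e' j‖ ≤ (r j)⁻¹) → (∀ j, ‖e j - e' j‖ ≤ d) → ∀ y : K, ‖y‖ ≤ 1 →
      ‖(entireMap p e)^[n] y - (entireMap p e')^[n] y‖ < η := by
  induction n generalizing η with
  | zero => exact ⟨1, one_pos, fun _ _ _ _ _ y _ => by simpa⟩
  | succ n ih =>
    set T := (growth p r)^[n] 1 with hTdef
    have hTρ : rho p < T := rho_lt_growth_iterate hr rho_lt_one n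
    have hT : 0 < T := rho_pos.trans hTρ
    have hG : 0 < growth p r T := hT.trans (lt_growth hr hTρ)
    obtain ⟨d, hd, h⟩ := ih (η := η / growth p r T * T) (by positivity)
    refine ⟨min d (η / growth p r T / (2 * T)), by positivity, fun e e' he he' hee y hy => ?_⟩
    rw [Function.iterate_succ_apply', Function.iterate_succ_apply']
    refine (norm_entireMap_sub_le_max hr hpK he he' hT (norm_iterate_entireMap_le hr hpK he hy n)
      (norm_iterate_entireMap_le hr hpK he' hy n) hee).trans_lt ?_
    rw [← lt_div_iff₀ hG]
    refine max_lt ?_ ?_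
    · rw [div_lt_iff₀ hT]
      exact h e e' he he' (fun j => (hee j).trans (min_le_left _ _)) y hy
    · have hx : 0 < η / growth p r T := by positivity
      calc T * min d (η / growth p r T / (2 * T))
          ≤ T * (η / growth p r T / (2 * T)) := by
            gcongr
            exact min_le_right _ _
        _ = η / growth p r T / 2 := by field_simp
        _ < _ := half_lt_self hx

lemma polyApprox_iterate (hr : RadiusSeq p r) (hpK : ‖(p : K)‖ = (p : ℝ)⁻¹) {S : Set K}
    {x : K[X]} (hx : ∀ v ∈ S, ‖x.eval v‖ ≤ 1) {E : ℕ → K[X]}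
    (hE : ∀ v ∈ S, ∀ j, ‖(E j).eval v‖ ≤ (r j)⁻¹) (n : ℕ) :
    PolyApprox S fun v => (entireMap p fun j => (E j).eval v)^[n] (x.eval v) := by
  induction n with
  | zero => exact polyApprox_eval S x
  | succ n ih =>
    simp only [Function.iterate_succ_apply']
    exact ih.entireMap hr hpK (rho_pos.trans (rho_lt_growth_iterate hr rho_lt_one n))
      (fun v hv => norm_iterate_entireMap_le hr hpK (hE v hv) (hx v hv) n) hE

/-- On the disk around the zero of modulus `r_k` the map is an expanding similarity. -/
lemma norm_entireMap_sub_eq (hr : RadiusSeq p r) (hpK : ‖(p : K)‖ = (p : ℝ)⁻¹) {e : ℕ → K}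
    (he : ∀ j, ‖e j‖ = (r j)⁻¹) {k : ℕ} {z w : K} (hz : ‖1 - e k * z‖ < 1)
    (hw : ‖1 - e k * w‖ < 1) :
    ‖entireMap p e z - entireMap p e w‖ = growth p r (r k) / r k * ‖z - w‖ := by
  rcases eq_or_ne z w with rfl | hzw
  · simp
  have hk := hr.pos k
  have hz' := norm_eq_of_norm_one_sub_mul_lt hk (he k) hz
  have hw' := norm_eq_of_norm_one_sub_mul_lt hk (he k) hw
  have hup := norm_update_le (fun j => (he j).le) (k := k) (v := 0) (by simpa using hk.le)
  set F := entireMap p (Function.update e k 0) with hF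
  have hFz : ‖F z‖ = growth p r (r k) := norm_entireMap_update_zero hr hpK he hz'
  have hFzw : ‖F z - F w‖ ≤ growth p r (r k) / r k * ‖z - w‖ := by
    refine (norm_entireMap_sub_le_max hr hpK hup hup hk hz'.le hw'.le
      (d := 0) (by simp)).trans_eq ?_
    rw [mul_zero, max_eq_left (by positivity)]
    ring
  have h1 : ‖e k * (w - z) * F z‖ = growth p r (r k) / r k * ‖z - w‖ := by
    rw [norm_mul, norm_mul, he, hFz, norm_sub_rev]
    ring
  have hpos : 0 < growth p r (r k) / r k * ‖z - w‖ := by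
    have : 0 < ‖z - w‖ := norm_pos_iff.2 (sub_ne_zero.2 hzw)
    have : 0 < growth p r (r k) := by
      rw [← hFz]
      have h := mul_pow_le_growth hr hk.le
      have hp0 : (0 : ℝ) < p := by exact_mod_cast hp.out.pos
      rw [hFz]
      exact lt_of_lt_of_le (by positivity) h
    positivity
  rw [entireMap_eq_mul_update hr (fun j => (he j).le) k z,
    entireMap_eq_mul_update hr (fun j => (he j).le) k w, ← hF]
  rw [show (1 - e k * z) * F z - (1 - e k * w) * F w
      = (1 - e k * w) * (F z - F w) + e k * (w - z) * F z by ring, ← h1]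
  refine norm_add_eq_of_lt ?_
  rw [h1, norm_mul]
  calc _ ≤ ‖1 - e k * w‖ * (growth p r (r k) / r k * ‖z - w‖) := by gcongr
    _ < 1 * (growth p r (r k) / r k * ‖z - w‖) := by gcongr
    _ = _ := one_mul _

lemma norm_iterate_sub_lt (hr : RadiusSeq p r) (hpK : ‖(p : K)‖ = (p : ℝ)⁻¹) {e e' : ℕ → K}
    (he : ∀ j, ‖e j‖ ≤ (r j)⁻¹) (he' : ∀ j, ‖e' j‖ ≤ (r j)⁻¹) {z z' : K} {τ d B : ℝ} {s q : ℕ}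
    (hτ : rho p < τ) (hz : ‖z‖ ≤ τ) (hz' : ‖z'‖ ≤ τ) (hzz : ‖z - z'‖ < rho p * τ)
    (hd : ∀ j, ‖e j - e' j‖ ≤ d) (hdB : d * B ≤ rho p) (hB : ∀ i < q, (growth p r)^[i] τ < B)
    (hs : ∀ i < s, (growth p r)^[i] τ ≤ 1) (i : ℕ) (hi : i ≤ q) :
    ‖(entireMap p e)^[i] z - (entireMap p e')^[i] z'‖
      < max (rho p * ((p : ℝ)⁻¹) ^ min i s) (d * B) * (growth p r)^[i] τ := by
  have hp1 : (1 : ℝ) < p := by exact_mod_cast hp.out.one_lt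
  have hρ := rho_pos (p := p)
  have hd0 : 0 ≤ d := (norm_nonneg _).trans (hd 0)
  induction i with
  | zero =>
    refine hzz.trans_le ?_
    have := hρ.trans hτ
    simp only [Function.iterate_zero, id_eq, zero_le, inf_of_le_left, pow_zero, mul_one]
    gcongr
    exact le_max_left _ _
  | succ i ih =>
    have ih := ih (by omega)
    have hTρ := rho_lt_growth_iterate hr hτ i
    have hTB := hB i (by omega)
    have hT1 := hs i
    have h1 := norm_iterate_entireMap_le hr hpK he hz i
    have h2 := norm_iterate_entireMap_le hr hpK he' hz' i
    rw [Function.iterate_succ_apply', Function.iterate_succ_apply', Function.iterate_succ_apply']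
    set T := (growth p r)^[i] τ with hTdef
    set z₁ := (entireMap p e)^[i] z
    set z₁' := (entireMap p e')^[i] z'
    have hT : 0 < T := hρ.trans hTρ
    have hG : 0 < growth p r T := hT.trans (lt_growth hr hTρ)
    have hTd : T * d < max (rho p * ((p : ℝ)⁻¹) ^ min (i + 1) s) (d * B) := by
      rcases hd0.eq_or_lt with rfl | hd0
      · refine lt_max_of_lt_left ?_
        rw [mul_zero]
        positivity
      · refine lt_max_of_lt_right ?_
        rw [mul_comm]
        gcongr
    rw [← div_lt_iff₀ hT] at ih
    rcases lt_or_ge i s with his | his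
    · rw [min_eq_left his.le] at ih
      rw [min_eq_left (by omega : i + 1 ≤ s)] at hTd ⊢
      have hle : ‖z₁ - z₁'‖ / T ≤ rho p := by
        refine ih.le.trans (max_le ?_ hdB)
        exact mul_le_of_le_one_right hρ.le (pow_le_one₀ (by positivity) (inv_le_one_of_one_le₀ hp1.le))
      refine (norm_entireMap_sub_le_of_le_one hr hpK he he' hT (hT1 his) h1 h2 hd
        (div_mul_cancel₀ _ hT.ne').ge hle).trans_lt ?_
      gcongr
      refine max_lt ?_ hTd
      rw [div_lt_iff₀ (by positivity)]
      refine ih.trans_le (max_le ?_ ?_)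
      · rw [← div_le_iff₀ (by positivity)]
        refine le_max_of_le_left (le_of_eq ?_)
        rw [pow_succ]
        ring
      · have hdB0 : 0 ≤ d * B := mul_nonneg hd0 (hT.trans hTB).le
        calc d * B ≤ d * B * p := le_mul_of_one_le_right hdB0 hp1.le
          _ ≤ _ := by
            gcongr
            exact le_max_right _ _
    · rw [min_eq_right his] at ih
      rw [min_eq_right (by omega : s ≤ i + 1)] at hTd ⊢
      refine (norm_entireMap_sub_le_max hr hpK he he' hT h1 h2 hd).trans_lt ?_
      gcongr
      exact max_lt ih hTd

end Dynamics

/-- The expansion factor of the entire map near its zero of modulus `r k`. -/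
def multiplier (p : ℕ) (r : ℕ → ℝ) (k : ℕ) : ℝ := growth p r (r k) / r k

section Landing

variable {p : ℕ} {r : ℕ → ℝ} {K : Type*} [NontriviallyNormedField K]

lemma RadiusSeq.one_lt [hp : Fact p.Prime] (hr : RadiusSeq p r) (k : ℕ) : 1 < r k :=
  calc (1 : ℝ) < p := by exact_mod_cast hp.out.one_lt
    _ < r 0 := hr.lt_zero
    _ ≤ r k := hr.strictMono.monotone k.zero_le

lemma one_lt_multiplier [Fact p.Prime] (hr : RadiusSeq p r) (k : ℕ) : 1 < multiplier p r k :=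
  (one_lt_div (hr.pos k)).2 (lt_growth hr (rho_lt_one.trans (hr.one_lt k)))

lemma exists_norm_sq_eq_multiplier [IsUltrametricDist K] [CompleteSpace K] [IsAlgClosed K]
    (hr : RadiusSeq p r) (hpK : ‖(p : K)‖ = (p : ℝ)⁻¹) {e : ℕ → K} (he : ∀ j, ‖e j‖ = (r j)⁻¹)
    (k : ℕ) : ∃ m : K, ‖m‖ ^ 2 = multiplier p r k := by
  have hc : ‖(e k)⁻¹‖ = r k := by rw [norm_inv, he, inv_inv]
  obtain ⟨m, hm⟩ := IsAlgClosed.exists_pow_nat_eq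
    (entireMap p (Function.update e k 0) (e k)⁻¹ / (e k)⁻¹) two_pos
  refine ⟨m, ?_⟩
  rw [← norm_pow, hm, norm_div, norm_entireMap_update_zero hr hpK he hc, hc, multiplier]

/-- A starting size whose `q`-th iterate hits `r k` after a prescribed stay in the unit disk. -/
lemma exists_delay [hp : Fact p.Prime] (hr : RadiusSeq p r) (k : ℕ) {X : ℝ} (hX : 0 < X) :
    ∃ (s q : ℕ) (τ : ℝ), s ≤ q ∧ rho p < τ ∧ τ < 1 ∧ (growth p r)^[q] τ = r k ∧
      (∀ i < q, (growth p r)^[i] τ < r k) ∧ (∀ i < s, (growth p r)^[i] τ ≤ 1) ∧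
      rho p * ((p : ℝ)⁻¹) ^ s * r k ≤ X := by
  have hp1 : (1 : ℝ) < p := by exact_mod_cast hp.out.one_lt
  have hρ := rho_pos (p := p)
  have hk := hr.pos k
  obtain ⟨s, hs⟩ := exists_pow_lt_of_lt_one (show 0 < X / (rho p * r k) by positivity)
    (inv_lt_one_of_one_lt₀ hp1)
  obtain ⟨n, hn⟩ := exists_lt_growth_iterate_one hr (r k)
  obtain ⟨τ, hτ, hq⟩ := exists_growth_iterate_eq hr (rho_lt_one.trans (hr.one_lt k)) (n + s)
  have hmono := growth_iterate_strictMono_index hr hτ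
  have hs1 : (growth p r)^[s] τ < 1 := by
    by_contra! h
    have := growth_iterate_mono hr zero_le_one h n
    rw [← Function.iterate_add_apply, hq] at this
    exact absurd hn (not_lt.2 this)
  refine ⟨s, n + s, τ, by omega, hτ, (hmono.monotone s.zero_le).trans_lt hs1, hq,
    fun i hi => hq ▸ hmono hi, fun i hi => ((hmono hi).trans hs1).le, ?_⟩
  rw [lt_div_iff₀ (by positivity)] at hs
  linarith

lemma closedBall_subset_closedBall [IsUltrametricDist K] {c v w : K} {ρ : ℝ}
    (hv : v ∈ Metric.closedBall c ρ) (hw : w ∈ Metric.closedBall c ρ) :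
    Metric.closedBall v ‖w - v‖ ⊆ Metric.closedBall c ρ := by
  rw [mem_closedBall_iff_norm] at hv hw
  intro u hu
  rw [mem_closedBall_iff_norm] at hu ⊢
  exact norm_sub_le_of_le (hu.trans (norm_sub_le_of_le hw (by rwa [norm_sub_rev]))) hv

variable [IsUltrametricDist K] [CompleteSpace K]

lemma entireMap_inv_eq_zero (hr : RadiusSeq p r) {e : ℕ → K} (he : ∀ j, ‖e j‖ = (r j)⁻¹) (k : ℕ) :
    entireMap p e (e k)⁻¹ = 0 := by
  have : e k ≠ 0 := by
    rw [← norm_pos_iff, he]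
    exact inv_pos.2 (hr.pos k)
  rw [entireMap_eq_mul_update hr (fun j => (he j).le) k, mul_inv_cancel₀ this, sub_self, zero_mul]

lemma norm_entireMap_eq_multiplier_mul [Fact p.Prime] (hr : RadiusSeq p r)
    (hpK : ‖(p : K)‖ = (p : ℝ)⁻¹) {e : ℕ → K} (he : ∀ j, ‖e j‖ = (r j)⁻¹) {k : ℕ} {z : K}
    (hz : ‖z - (e k)⁻¹‖ < r k) :
    ‖entireMap p e z‖ = multiplier p r k * ‖z - (e k)⁻¹‖ := by
  have hk := hr.pos k
  have hek : e k ≠ 0 := by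
    rw [← norm_pos_iff, he]
    exact inv_pos.2 hk
  have h1 : ‖1 - e k * z‖ < 1 := by
    rw [show 1 - e k * z = -(e k * (z - (e k)⁻¹)) by field_simp; ring, norm_neg, norm_mul, he,
      inv_mul_lt_one₀ hk]
    exact hz
  have := norm_entireMap_sub_eq hr hpK he h1 (w := (e k)⁻¹) (by simp [hek])
  rwa [entireMap_inv_eq_zero hr he, sub_zero] at this

/-- In a polynomial family whose iterates reach both arbitrarily small and large sizes, some
parameter makes the orbit land near a fixed point of modulus `r k`. -/
lemma exists_landing_parameter [Fact p.Prime] [IsAlgClosed K] (hr : RadiusSeq p r)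
    (hpK : ‖(p : K)‖ = (p : ℝ)⁻¹)
    (hgen : ∀ i j n, i < j → 1 ≤ n → (growth p r)^[n] (r i) ≠ r j) {e₀ : ℕ → K} {k : ℕ} {c : K}
    {ρ : ℝ} {E : ℕ → K[X]} {x : K[X]}
    (hE : ∀ v ∈ Metric.closedBall c ρ, ∀ j, ‖(E j).eval v‖ = (r j)⁻¹)
    (hE₀ : ∀ v ∈ Metric.closedBall c ρ, (E k).eval v = e₀ k)
    (hx : ∀ v ∈ Metric.closedBall c ρ, ‖x.eval v‖ ≤ 1) {L : ℕ}
    (hsmall : ∀ τ > 0, ∃ v ∈ Metric.closedBall c ρ,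
      ‖(entireMap p fun j => (E j).eval v)^[L] (x.eval v)‖ < τ)
    (hlarge : ∃ v ∈ Metric.closedBall c ρ,
      1 ≤ ‖(entireMap p fun j => (E j).eval v)^[L] (x.eval v)‖)
    {τ η : ℝ} {q : ℕ} (hτ : rho p < τ) (hτ1 : τ < 1) (hq : (growth p r)^[q] τ = r k)
    (hlt : ∀ i < q, (growth p r)^[i] τ < r k) (hη : 0 < η) :
    ∃ v ∈ Metric.closedBall c ρ,
      ‖(entireMap p fun j => (E j).eval v)^[L] (x.eval v)‖ ≤ τ ∧
      ‖(entireMap p fun j => (E j).eval v)^[q + L] (x.eval v)‖ = r k ∧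
      ‖entireMap p (fun j => (E j).eval v)
          ((entireMap p fun j => (E j).eval v)^[q + L] (x.eval v))
        - (entireMap p fun j => (E j).eval v)^[q + L] (x.eval v)‖ < η := by
  set S := Metric.closedBall c ρ with hS
  set G : ℕ → K → K := fun n v => (entireMap p fun j => (E j).eval v)^[n] (x.eval v) with hGdef
  have hG : ∀ n, PolyApprox S (G n) := polyApprox_iterate hr hpK hx fun v hv j => (hE v hv j).le
  have hGs : ∀ v, G (q + L) v = (entireMap p fun j => (E j).eval v)^[q] (G L v) := fun v =>
    Function.iterate_add_apply _ _ _ _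
  have hGS : ∀ v, G (q + L + 1) v = entireMap p (fun j => (E j).eval v) (G (q + L) v) := fun v =>
    Function.iterate_succ_apply' _ _ _
  have hk := hr.pos k
  have hτ0 : 0 < τ := rho_pos.trans hτ
  set lam := multiplier p r k with hlam
  have hlam1 : 1 < lam := one_lt_multiplier hr k
  obtain ⟨v₁, hv₁, h₁⟩ := hlarge
  obtain ⟨v₀, hv₀, h₀⟩ := hsmall τ hτ0
  have hek : ‖e₀ k‖ = (r k)⁻¹ := by rw [← hE₀ v₀ hv₀, hE v₀ hv₀]
  have hck : ‖(e₀ k)⁻¹‖ = r k := by rw [norm_inv, hek, inv_inv]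
  obtain ⟨ω, hω⟩ := exists_norm_eq_of_growth_iterate_eq hr hpK (hE v₀ hv₀) hτ q (hck.trans hq.symm)
  obtain ⟨m, hm⟩ := exists_norm_sq_eq_multiplier hr hpK (hE v₀ hv₀) k
  have hm1 : 1 < ‖m‖ := by
    by_contra! h
    have := pow_le_one₀ (n := 2) (norm_nonneg m) h
    rw [hm] at this
    exact absurd hlam1 (not_lt.2 this)
  have hm0 : 0 < ‖m‖ := one_pos.trans hm1
  rw [← hlam] at hm
  obtain ⟨v', hv'₁, hv', hmax⟩ := ((hG L).mono (closedBall_subset_closedBall hv₀ hv₁)).exists_norm_eq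
    (ω := ω) (by rwa [hω]) (by rw [hω]; exact hτ1.le.trans h₁)
  rw [hω] at hv'
  have hS₁ : Metric.closedBall v₀ ‖v' - v₀‖ ⊆ S :=
    (Metric.closedBall_subset_closedBall hv'₁).trans (closedBall_subset_closedBall hv₀ hv₁)
  have hv'S : v' ∈ S := hS₁ (by rw [mem_closedBall_iff_norm])
  have hres : ∀ i < q, ∀ j, (growth p r)^[i] ‖G L v'‖ ≠ r j := by
    intro i hi j hj
    rw [hv'] at hj
    have hjk : j < k := hr.strictMono.lt_iff_lt.1 (hj ▸ hlt i hi)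
    refine hgen j k (q - i) hjk (by omega) ?_
    rw [← hj, ← Function.iterate_add_apply, Nat.sub_add_cancel hi.le, hq]
  have hMv' : ‖G (q + L) v'‖ = r k := by
    rw [hGs, norm_iterate_entireMap_eq hr hpK (hE v' hv'S) q hres, hv', hq]
  have hMv₀ : ‖G (q + L) v₀‖ < r k := by
    rw [hGs, ← hq]
    exact (norm_iterate_entireMap_le hr hpK (fun j => (hE v₀ hv₀ j).le) le_rfl q).trans_lt
      (growth_iterate_strictMono hr (Fact.out : p.Prime).ne_zero (norm_nonneg _) h₀ q)
  obtain ⟨v₂, hv₂, h₂⟩ := ((hG (q + L)).mono hS₁).exists_norm_sub_lt (w := (e₀ k)⁻¹)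
    (η := r k / lam) (by
      rw [norm_sub_rev, norm_sub_eq_of_lt (by rwa [hck]), hck, norm_sub_rev (G (q + L) v'),
        norm_sub_eq_of_lt (by rwa [hMv']), hMv']) (by positivity)
  have hrlam : r k / lam < r k := div_lt_self hk hlam1
  have hv₂S : v₂ ∈ S := hS₁ (by rwa [mem_closedBall_iff_norm])
  have hS₂ : Metric.closedBall v₂ ‖v₀ - v₂‖ ⊆ Metric.closedBall v₀ ‖v' - v₀‖ :=
    closedBall_subset_closedBall (by rwa [mem_closedBall_iff_norm])
      (Metric.mem_closedBall_self (norm_nonneg _))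
  have hω' : ‖(e₀ k)⁻¹ / m‖ = r k / ‖m‖ := by rw [norm_div, hck]
  have hγ1 : r k / lam < r k / ‖m‖ := by
    gcongr
    rw [← hm]
    exact lt_self_pow₀ hm1 one_lt_two
  have hγ2 : r k / ‖m‖ < r k := div_lt_self hk hm1
  have hmk : lam * (r k / ‖m‖) = r k * ‖m‖ := by
    rw [← hm]
    field_simp
  have hsub : PolyApprox S fun v => G (q + L) v - (e₀ k)⁻¹ := by
    simpa using (hG (q + L)).sub (polyApprox_eval S (C (e₀ k)⁻¹))
  obtain ⟨v₃, hv₃₂, hv₃, hmax₃⟩ := (hsub.mono (hS₂.trans hS₁)).exists_norm_eq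
    (ω := (e₀ k)⁻¹ / m) (by rw [hω']; exact h₂.trans hγ1)
    (by rw [hω', norm_sub_eq_of_lt (by rwa [hck]), hck]; exact hγ2.le)
  rw [hω'] at hv₃ hmax₃
  have hS₃ : Metric.closedBall v₂ ‖v₃ - v₂‖ ⊆ Metric.closedBall v₀ ‖v' - v₀‖ :=
    (Metric.closedBall_subset_closedBall hv₃₂).trans hS₂
  have hnext : ∀ v ∈ S, ‖G (q + L) v - (e₀ k)⁻¹‖ < r k →
      ‖G (q + L + 1) v‖ = lam * ‖G (q + L) v - (e₀ k)⁻¹‖ := by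
    intro v hv h
    rw [hGS, ← hE₀ v hv]
    exact norm_entireMap_eq_multiplier_mul hr hpK (hE v hv) (by rwa [hE₀ v hv])
  have hnorm : ∀ v, ‖G (q + L) v - (e₀ k)⁻¹‖ < r k → ‖G (q + L) v‖ = r k := fun v h => by
    rw [← hck]
    exact norm_eq_of_norm_sub_lt (by rwa [hck])
  have hv₃S : v₃ ∈ S := hS₁ (hS₃ (by rw [mem_closedBall_iff_norm]))
  have hH₂ : ‖G (q + L + 1) v₂ - G (q + L) v₂‖ = r k := by
    rw [norm_sub_eq_of_lt, hnorm v₂ (h₂.trans hrlam)]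
    rw [hnorm v₂ (h₂.trans hrlam), hnext v₂ hv₂S (h₂.trans hrlam)]
    rwa [lt_div_iff₀' (by positivity)] at h₂
  have hH₃ : ‖G (q + L + 1) v₃ - G (q + L) v₃‖ = r k * ‖m‖ := by
    have h₃ : ‖G (q + L + 1) v₃‖ = r k * ‖m‖ := by
      rw [hnext v₃ hv₃S (hv₃.trans_lt hγ2), hv₃, hmk]
    rw [norm_sub_rev, norm_sub_eq_of_lt, h₃]
    rw [h₃, hnorm v₃ (hv₃.trans_lt hγ2)]
    exact lt_mul_of_one_lt_right hk hm1
  have hlt' : r k < r k * ‖m‖ := lt_mul_of_one_lt_right hk hm1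
  obtain ⟨v, hv, hHv⟩ := (((hG (q + L + 1)).sub (hG (q + L))).mono (hS₃.trans hS₁)).exists_norm_sub_lt
    (w := 0) (η := η) (by
      rw [zero_sub, norm_neg, hH₂, norm_sub_rev, norm_sub_eq_of_lt (by rwa [hH₂, hH₃]), hH₃]
      exact hlt'.le) hη
  have hvS' : v ∈ Metric.closedBall v₀ ‖v' - v₀‖ := hS₃ (by rwa [mem_closedBall_iff_norm])
  refine ⟨v, hS₁ hvS', ?_, hnorm v ((hmax₃ v hv).trans_lt hγ2), ?_⟩
  · rw [mem_closedBall_iff_norm] at hvS'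
    rw [← hω]
    exact hmax v hvS'
  · rw [sub_zero, hGS] at hHv
    exact hHv

end Landing

/-- The orbit of `x` under the map with coefficients `e` visits the unit disk and then, at time
`N`, lands at a point of modulus `r k` which is nearly fixed. This persists, uniformly on a disk
around `x`, under perturbations of `e` of size `multiplier p r k ^ (-ℓ) / r k`. -/
structure Landing (p : ℕ) (r : ℕ → ℝ) {K : Type*} [NormedField K] (e₀ : ℕ → K) (k : ℕ)
    (e : ℕ → K) (x : K) (N ℓ : ℕ) : Prop where
  norm_coeff : ∀ j, ‖e j‖ = (r j)⁻¹
  coeff_eq : ∀ j, k ≤ j → e j = e₀ j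
  norm_le_one : ‖x‖ ≤ 1
  pos : 1 ≤ ℓ
  le : k ≤ N
  norm_iterate : ‖(entireMap p e)^[N] x‖ = r k
  norm_sub_lt : ‖entireMap p e ((entireMap p e)^[N] x) - (entireMap p e)^[N] x‖
    < r k * (multiplier p r k ^ ℓ)⁻¹
  stable : ∀ e' : ℕ → K, (∀ j, ‖e' j‖ = (r j)⁻¹) →
    (∀ j, ‖e' j - e j‖ ≤ (multiplier p r k ^ ℓ)⁻¹ / r k) →
    ‖(entireMap p e')^[N] x - (entireMap p e)^[N] x‖ < r k * (multiplier p r k ^ ℓ)⁻¹ ∧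
    ∀ y, ‖y - x‖ < rho p ^ 2 →
      ‖(entireMap p e')^[N] y - (entireMap p e')^[N] x‖
        < rho p ^ 2 * (multiplier p r k ^ ℓ)⁻¹ ∧
      ∃ n, k ≤ n ∧ ‖(entireMap p e')^[n] y‖ < 1

section Step

variable {p : ℕ} [hp : Fact p.Prime] {r : ℕ → ℝ} {K : Type*} [NontriviallyNormedField K]
  [IsUltrametricDist K] [CompleteSpace K] [IsAlgClosed K]

lemma exists_landing (hr : RadiusSeq p r) (hpK : ‖(p : K)‖ = (p : ℝ)⁻¹)
    (hgen : ∀ i j n, i < j → 1 ≤ n → (growth p r)^[n] (r i) ≠ r j) {e₀ : ℕ → K} {k : ℕ} {c : K}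
    {ρ : ℝ} {E : ℕ → K[X]} {x : K[X]}
    (hE : ∀ v ∈ Metric.closedBall c ρ, ∀ j, ‖(E j).eval v‖ = (r j)⁻¹)
    (hE₀ : ∀ v ∈ Metric.closedBall c ρ, ∀ j, k ≤ j → (E j).eval v = e₀ j)
    (hx : ∀ v ∈ Metric.closedBall c ρ, ‖x.eval v‖ ≤ 1) {L : ℕ} (hL : k ≤ L)
    (hsmall : ∀ τ > 0, ∃ v ∈ Metric.closedBall c ρ,
      ‖(entireMap p fun j => (E j).eval v)^[L] (x.eval v)‖ < τ)
    (hlarge : ∃ v ∈ Metric.closedBall c ρ,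
      1 ≤ ‖(entireMap p fun j => (E j).eval v)^[L] (x.eval v)‖)
    (hdisk : ∀ v ∈ Metric.closedBall c ρ, ∀ y, ‖y - x.eval v‖ < rho p ^ 2 →
      ‖(entireMap p fun j => (E j).eval v)^[L] y
        - (entireMap p fun j => (E j).eval v)^[L] (x.eval v)‖ < rho p ^ 2)
    {d₀ : ℝ} (hd₀ : 0 < d₀) :
    ∃ v ∈ Metric.closedBall c ρ, ∃ N ℓ, (multiplier p r k ^ ℓ)⁻¹ / r k ≤ d₀ ∧
      Landing p r e₀ k (fun j => (E j).eval v) (x.eval v) N ℓ := by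
  have hρ := rho_pos (p := p)
  have hρ1 := rho_lt_one (p := p)
  have hρ2 : rho p ^ 2 < 1 := pow_lt_one₀ hρ.le hρ1 two_ne_zero
  have hk := hr.pos k
  have hlam1 := one_lt_multiplier hr k
  have hlam0 : 0 < multiplier p r k := one_pos.trans hlam1
  obtain ⟨d₁, hd₁, hsoft⟩ := exists_forall_norm_iterate_sub_lt (K := K) hr hpK L
    (show 0 < rho p ^ 2 by positivity)
  obtain ⟨ℓ, hℓ⟩ := exists_pow_lt_of_lt_one
    (show 0 < min (min (d₀ * r k) (d₁ * r k)) (rho p) by positivity)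
    (inv_lt_one_of_one_lt₀ hlam1)
  have hX : (multiplier p r k ^ (ℓ + 1))⁻¹ < min (min (d₀ * r k) (d₁ * r k)) (rho p) := by
    refine lt_of_le_of_lt ?_ hℓ
    rw [← inv_pow]
    exact pow_le_pow_of_le_one (by positivity) (inv_le_one_of_one_le₀ hlam1.le) ℓ.le_succ
  set X := (multiplier p r k ^ (ℓ + 1))⁻¹ with hXdef
  have hX0 : 0 < X := by positivity
  obtain ⟨hX1, hXρ⟩ := lt_min_iff.1 hX
  obtain ⟨hXd₀, hXd₁⟩ := lt_min_iff.1 hX1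
  rw [← div_lt_iff₀ hk] at hXd₀ hXd₁
  obtain ⟨s, q, τ, hsq, hτ, hτ1, hq, hlt, hs, hsX⟩ := exists_delay hr k
    (show 0 < rho p ^ 2 * X by positivity)
  obtain ⟨v, hv, hvL, hvN, hvH⟩ := exists_landing_parameter hr hpK hgen hE
    (fun v hv => hE₀ v hv k le_rfl) hx hsmall hlarge hτ hτ1 hq hlt
    (show 0 < r k * X by positivity)
  refine ⟨v, hv, q + L, ℓ + 1, hXd₀.le, hE v hv, hE₀ v hv, hx v hv, by omega, by omega, hvN, hvH,
    fun e' he' hee' => ?_⟩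
  set e : ℕ → K := fun j => (E j).eval v with he
  have heb : ∀ j, ‖e j‖ ≤ (r j)⁻¹ := fun j => (hE v hv j).le
  have heb' : ∀ j, ‖e' j‖ ≤ (r j)⁻¹ := fun j => (he' j).le
  have hclose : ∀ y : K, ‖y‖ ≤ 1 →
      ‖(entireMap p e')^[L] y - (entireMap p e)^[L] y‖ < rho p ^ 2 :=
    hsoft e' e heb' heb fun j => (hee' j).trans hXd₁.le
  have hρτ : rho p ^ 2 < rho p * τ := by
    rw [sq]
    gcongr
  have hρ2τ : rho p ^ 2 < τ := hρτ.trans_le (mul_le_of_le_one_left (hρ.trans hτ).le hρ1.le)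
  have hle : ∀ z : K, ‖z - (entireMap p e)^[L] (x.eval v)‖ < rho p ^ 2 → ‖z‖ ≤ τ := fun z hz =>
    norm_le_of_norm_sub_le (hz.le.trans hρ2τ.le) hvL
  have hXB : X / r k * r k = X := div_mul_cancel₀ _ hk.ne'
  have hx' := hclose _ (hx v hv)
  refine ⟨?_, fun y hy => ?_⟩
  · have := norm_iterate_sub_lt hr hpK heb' heb hτ (hle _ hx') hvL (hx'.trans hρτ) hee'
      (by rw [hXB]; exact hXρ.le) hlt hs q le_rfl
    rw [Function.iterate_add_apply, Function.iterate_add_apply]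
    refine this.trans_le ?_
    rw [min_eq_right hsq, hXB, hq, mul_comm]
    gcongr
    refine max_le ?_ le_rfl
    rw [← mul_le_mul_iff_left₀ hk]
    refine hsX.trans ?_
    rw [mul_comm X]
    gcongr
    exact hρ2.le.trans (hr.one_lt k).le
  · have hy1 : ‖y‖ ≤ 1 := norm_le_of_norm_sub_le (hy.le.trans hρ2.le) (hx v hv)
    have hyx : ‖(entireMap p e')^[L] y - (entireMap p e)^[L] (x.eval v)‖ < rho p ^ 2 :=
      norm_sub_lt_of_lt (hclose y hy1) (hdisk v hv y hy)
    have hyx' : ‖(entireMap p e')^[L] y - (entireMap p e')^[L] (x.eval v)‖ < rho p ^ 2 :=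
      norm_sub_lt_of_lt hyx (by rwa [norm_sub_rev])
    refine ⟨?_, L, hL, (hle _ hyx).trans_lt hτ1⟩
    have := norm_iterate_sub_lt hr hpK heb' heb' (d := 0) hτ (hle _ hyx) (hle _ hx')
      (hyx'.trans hρτ) (by simp) (by rw [zero_mul]; exact hρ.le) hlt hs q le_rfl
    rw [Function.iterate_add_apply, Function.iterate_add_apply]
    refine this.trans_le ?_
    have hp0 : (0 : ℝ) < p := by exact_mod_cast hp.out.pos
    rw [min_eq_right hsq, zero_mul, hq, max_eq_left (by positivity)]
    exact hsX

end Step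

section Expansion

variable {K : Type*} [NormedField K] [IsUltrametricDist K] {g : K → K} {a z w : K}
  {R lam δ : ℝ} {ℓ : ℕ}

lemma norm_iterate_sub_le_of_expanding
    (hg : ∀ z w, ‖z - a‖ < R → ‖w - a‖ < R → ‖g z - g w‖ = lam * ‖z - w‖) (hlam : 1 < lam)
    (hδ : 0 < δ) (hR : lam ^ ℓ * δ = R) (ha : ‖g a - a‖ ≤ lam * δ) (hz : ‖z - a‖ ≤ δ) {i : ℕ}
    (hi : i ≤ ℓ) : ‖g^[i] z - a‖ ≤ lam ^ i * δ := by
  have hR0 : 0 < R := by rw [← hR]; positivity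
  induction i with
  | zero => simpa using hz
  | succ i ih =>
    have ih := ih (by omega)
    have hlt : ‖g^[i] z - a‖ < R := by
      rw [← hR]
      exact ih.trans_lt (mul_lt_mul_of_pos_right (pow_lt_pow_right₀ hlam (by omega)) hδ)
    rw [Function.iterate_succ_apply']
    refine norm_sub_le_of_le (y := g a) ?_ (ha.trans ?_)
    · rw [hg _ _ hlt (by simpa using hR0), pow_succ', mul_assoc]
      gcongr
    · gcongr
      exact le_self_pow₀ hlam.le (by omega)

lemma norm_iterate_sub_eq_of_expanding
    (hg : ∀ z w, ‖z - a‖ < R → ‖w - a‖ < R → ‖g z - g w‖ = lam * ‖z - w‖) (hlam : 1 < lam)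
    (hδ : 0 < δ) (hR : lam ^ ℓ * δ = R) (ha : ‖g a - a‖ ≤ lam * δ) (hz : ‖z - a‖ ≤ δ)
    (hw : ‖w - a‖ ≤ δ) {i : ℕ} (hi : i ≤ ℓ) : ‖g^[i] z - g^[i] w‖ = lam ^ i * ‖z - w‖ := by
  induction i with
  | zero => simp
  | succ i ih =>
    have hlt : lam ^ i * δ < R := by
      rw [← hR]
      exact mul_lt_mul_of_pos_right (pow_lt_pow_right₀ hlam (by omega)) hδ
    rw [Function.iterate_succ_apply', Function.iterate_succ_apply', hg, ih (by omega), pow_succ',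
      mul_assoc]
    · exact (norm_iterate_sub_le_of_expanding hg hlam hδ hR ha hz (by omega)).trans_lt hlt
    · exact (norm_iterate_sub_le_of_expanding hg hlam hδ hR ha hw (by omega)).trans_lt hlt

lemma norm_iterate_succ_sub_of_expanding
    (hg : ∀ z w, ‖z - a‖ < R → ‖w - a‖ < R → ‖g z - g w‖ = lam * ‖z - w‖) (hlam : 1 < lam)
    (hδ : 0 < δ) (hR : lam ^ ℓ * δ = R) (ha : ‖g a - a‖ = lam * δ) (hz : ‖z - a‖ < δ) {i : ℕ}
    (hi : i + 1 ≤ ℓ) : ‖g^[i + 1] z - a‖ = lam ^ (i + 1) * δ := by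
  have hR0 : 0 < R := by rw [← hR]; positivity
  have hlt : ‖g^[i] z - a‖ < R := by
    rw [← hR]
    exact (norm_iterate_sub_le_of_expanding hg hlam hδ hR ha.le hz.le (by omega)).trans_lt
      (mul_lt_mul_of_pos_right (pow_lt_pow_right₀ hlam (by omega)) hδ)
  have h1 := hg _ a hlt (by simpa using hR0)
  rw [Function.iterate_succ_apply', ← sub_add_sub_cancel _ (g a)]
  induction i with
  | zero =>
    rw [norm_add_eq_of_lt, ha, zero_add, pow_one]
    rw [ha, h1]
    exact mul_lt_mul_of_pos_left hz (one_pos.trans hlam)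
  | succ i ih =>
    have hlt' : ‖g^[i] z - a‖ < R := by
      rw [← hR]
      exact (norm_iterate_sub_le_of_expanding hg hlam hδ hR ha.le hz.le (by omega)).trans_lt
        (mul_lt_mul_of_pos_right (pow_lt_pow_right₀ hlam (by omega)) hδ)
    have ih := ih (by omega) hlt' (hg _ _ hlt' (by simpa using hR0))
    rw [sub_add_sub_cancel, ← Function.iterate_succ_apply' g] at ih
    have h2 : ‖g (g^[i + 1] z) - g a‖ = lam ^ (i + 1 + 1) * δ := by
      rw [h1, ih, pow_succ' _ (i + 1), mul_assoc]
    rw [add_comm, norm_add_eq_of_lt, h2]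
    rw [h2, ha]
    gcongr
    exact lt_self_pow₀ hlam (by omega)

lemma norm_iterate_sub_lt_of_expanding
    (hg : ∀ z w, ‖z - a‖ < R → ‖w - a‖ < R → ‖g z - g w‖ = lam * ‖z - w‖) (hlam : 1 < lam)
    (hδ : 0 < δ) (hR : lam ^ ℓ * δ = R) (ha : ‖g a - a‖ < δ) {i : ℕ} (hi : i ≤ ℓ) :
    ‖g^[i] a - a‖ < lam ^ i * δ := by
  have hR0 : 0 < R := by rw [← hR]; positivity
  induction i with
  | zero => simpa using hδ
  | succ i ih =>
    have ih := ih (by omega)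
    have hlt : ‖g^[i] a - a‖ < R := by
      rw [← hR]
      exact ih.trans (mul_lt_mul_of_pos_right (pow_lt_pow_right₀ hlam (by omega)) hδ)
    rw [Function.iterate_succ_apply']
    refine norm_sub_lt_of_lt (y := g a) ?_ (ha.trans_le ?_)
    · rw [hg _ _ hlt (by simpa using hR0), pow_succ', mul_assoc]
      gcongr
    · exact le_mul_of_one_le_left hδ.le (one_le_pow₀ hlam.le)

end Expansion

section Induction

variable {p : ℕ} [hp : Fact p.Prime] {r : ℕ → ℝ} {K : Type*} [NontriviallyNormedField K]
  {e₀ e : ℕ → K} {k : ℕ} {x v : K} {N ℓ : ℕ}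

lemma norm_update_sub_le (hr : RadiusSeq p r)
    (hv : ‖v - e k‖ ≤ (multiplier p r k ^ ℓ)⁻¹ / r k) (j : ℕ) :
    ‖Function.update e k v j - e j‖ ≤ (multiplier p r k ^ ℓ)⁻¹ / r k := by
  rcases eq_or_ne j k with rfl | hj
  · simpa using hv
  · have := hr.pos k
    have := one_lt_multiplier hr k
    simp only [Function.update_of_ne hj, sub_self, norm_zero]
    positivity

namespace Landing

lemma inv_pow_lt_one (hr : RadiusSeq p r) (h : Landing p r e₀ k e x N ℓ) :
    (multiplier p r k ^ ℓ)⁻¹ < 1 :=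
  inv_lt_one_of_one_lt₀ (one_lt_pow₀ (one_lt_multiplier hr k) (by have := h.pos; omega))

variable [IsUltrametricDist K]

lemma norm_eq_inv (hr : RadiusSeq p r) (h : Landing p r e₀ k e x N ℓ)
    (hv : ‖v - e k‖ ≤ (multiplier p r k ^ ℓ)⁻¹ / r k) : ‖v‖ = (r k)⁻¹ := by
  rw [← h.norm_coeff k]
  refine norm_eq_of_norm_sub_lt (hv.trans_lt ?_)
  rw [h.norm_coeff, div_eq_mul_inv]
  exact mul_lt_of_lt_one_left (inv_pos.2 (hr.pos k)) (h.inv_pow_lt_one hr)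

lemma norm_update (hr : RadiusSeq p r) (h : Landing p r e₀ k e x N ℓ)
    (hv : ‖v - e k‖ ≤ (multiplier p r k ^ ℓ)⁻¹ / r k) (j : ℕ) :
    ‖Function.update e k v j‖ = (r j)⁻¹ := by
  rcases eq_or_ne j k with rfl | hj
  · simpa using h.norm_eq_inv hr hv
  · simpa [hj] using h.norm_coeff j

variable [CompleteSpace K]

lemma norm_one_sub_mul_lt (hr : RadiusSeq p r) (hpK : ‖(p : K)‖ = (p : ℝ)⁻¹)
    (h : Landing p r e₀ k e x N ℓ) : ‖1 - e k * (entireMap p e)^[N] x‖ < 1 := by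
  have hk := hr.pos k
  have hlt : ‖entireMap p e ((entireMap p e)^[N] x)‖ = r k := by
    rw [← h.norm_iterate]
    refine norm_eq_of_norm_sub_lt (h.norm_sub_lt.trans ?_)
    rw [h.norm_iterate]
    exact mul_lt_of_lt_one_right hk (h.inv_pow_lt_one hr)
  rw [entireMap_eq_mul_update hr (fun j => (h.norm_coeff j).le) k, norm_mul,
    norm_entireMap_update_zero hr hpK h.norm_coeff h.norm_iterate] at hlt
  have hG : r k < growth p r (r k) := lt_growth hr (rho_lt_one.trans (hr.one_lt k))
  exact lt_of_mul_lt_mul_right (by rwa [one_mul, hlt]) (growth_nonneg hr hk.le)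

lemma expanding (hr : RadiusSeq p r) (hpK : ‖(p : K)‖ = (p : ℝ)⁻¹)
    (h : Landing p r e₀ k e x N ℓ) (hv : ‖v - e k‖ ≤ (multiplier p r k ^ ℓ)⁻¹ / r k) (z w : K)
    (hz : ‖z - (entireMap p e)^[N] x‖ < r k) (hw : ‖w - (entireMap p e)^[N] x‖ < r k) :
    ‖entireMap p (Function.update e k v) z - entireMap p (Function.update e k v) w‖
      = multiplier p r k * ‖z - w‖ := by
  have hk := hr.pos k
  set a := (entireMap p e)^[N] x with ha
  have key : ∀ u, ‖u - a‖ < r k → ‖1 - Function.update e k v k * u‖ < 1 := by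
    intro u hu
    rw [Function.update_self, show 1 - v * u = 1 - e k * a - (v - e k) * a - v * (u - a) by ring]
    refine norm_sub_lt_of_norm_lt (norm_sub_lt_of_norm_lt (h.norm_one_sub_mul_lt hr hpK) ?_) ?_
    · rw [norm_mul, h.norm_iterate, ← lt_div_iff₀ hk]
      exact hv.trans_lt (div_lt_div_of_pos_right (h.inv_pow_lt_one hr) hk)
    · rwa [norm_mul, h.norm_eq_inv hr hv, inv_mul_lt_one₀ hk]
  exact norm_entireMap_sub_eq hr hpK (h.norm_update hr hv) (key z hz) (key w hw)

lemma norm_update_sub (hr : RadiusSeq p r) (hpK : ‖(p : K)‖ = (p : ℝ)⁻¹)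
    (h : Landing p r e₀ k e x N ℓ) (hv : ‖v - e k‖ ≤ (multiplier p r k ^ ℓ)⁻¹ / r k) :
    ‖entireMap p (Function.update e k v) ((entireMap p e)^[N] x)
      - entireMap p e ((entireMap p e)^[N] x)‖ = multiplier p r k * (r k ^ 2 * ‖v - e k‖) := by
  have hk := hr.pos k
  rw [norm_entireMap_update_sub hr hpK h.norm_coeff (h.norm_eq_inv hr hv) h.norm_iterate,
    multiplier]
  field_simp

variable [IsAlgClosed K]

/-- Moving the `k`-th coefficient of a landing orbit sends it back to the unit disk, from where it
can be made to land at modulus `r (k + 1)`. -/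
lemma exists_succ (hr : RadiusSeq p r) (hpK : ‖(p : K)‖ = (p : ℝ)⁻¹)
    (hgen : ∀ i j n, i < j → 1 ≤ n → (growth p r)^[n] (r i) ≠ r j)
    (h : Landing p r e₀ k e x N ℓ) {d₀ : ℝ} (hd₀ : 0 < d₀) :
    ∃ v N' ℓ', ‖v - e k‖ ≤ (multiplier p r k ^ ℓ)⁻¹ / r k ∧
      (multiplier p r (k + 1) ^ ℓ')⁻¹ / r (k + 1) ≤ d₀ ∧
      Landing p r e₀ (k + 1) (Function.update e k v) x N' ℓ' := by
  have hk := hr.pos k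
  have hlam := one_lt_multiplier hr k
  have hlam0 : 0 < multiplier p r k := one_pos.trans hlam
  have hρ := rho_pos (p := p)
  have hρ2 : rho p ^ 2 < 1 := pow_lt_one₀ hρ.le rho_lt_one two_ne_zero
  have hX0 : 0 < (multiplier p r k ^ ℓ)⁻¹ := by positivity
  have hδ : 0 < r k * (multiplier p r k ^ ℓ)⁻¹ := by positivity
  have hR : multiplier p r k ^ ℓ * (r k * (multiplier p r k ^ ℓ)⁻¹) = r k := by field_simp
  have hδlt : r k * (multiplier p r k ^ ℓ)⁻¹
      < multiplier p r k * (r k * (multiplier p r k ^ ℓ)⁻¹) := lt_mul_of_one_lt_left hδ hlam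
  have hd : r k ^ 2 * ((multiplier p r k ^ ℓ)⁻¹ / r k) = r k * (multiplier p r k ^ ℓ)⁻¹ := by
    field_simp
  have hd0 : 0 < (multiplier p r k ^ ℓ)⁻¹ / r k := by positivity
  set a := (entireMap p e)^[N] x with ha
  set E : ℕ → K[X] := Function.update (fun j => C (e j)) k Polynomial.X with hEdef
  have hE : ∀ v, (fun j => (E j).eval v) = Function.update e k v := by
    intro v
    funext j
    rcases eq_or_ne j k with rfl | hj
    · simp [hEdef]
    · simp [hEdef, hj]
  have hEj : ∀ v j, (E j).eval v = Function.update e k v j := fun v j => congrFun (hE v) j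
  have hga : ∀ v, ‖v - e k‖ ≤ (multiplier p r k ^ ℓ)⁻¹ / r k →
      ‖entireMap p (Function.update e k v) a - a‖
        ≤ multiplier p r k * (r k * (multiplier p r k ^ ℓ)⁻¹) := by
    intro v hv
    refine norm_sub_le_of_le (y := entireMap p e a) ?_ (h.norm_sub_lt.le.trans hδlt.le)
    rw [h.norm_update_sub hr hpK hv, ← hd]
    gcongr
  have hstable := fun v hv => h.stable (Function.update e k v) (h.norm_update hr hv)
    (norm_update_sub_le hr hv)
  have hself : ‖(entireMap p e)^[ℓ + N] x - a‖ < r k := by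
    have := norm_iterate_sub_lt_of_expanding
      (h.expanding hr hpK (v := e k) (by simpa using hd0.le)) hlam hδ hR
      (by simpa using h.norm_sub_lt) le_rfl
    rwa [Function.update_eq_self, hR, ← ha, ha, ← Function.iterate_add_apply] at this
  have hself' : ‖(entireMap p e)^[ℓ + N] x‖ = r k := by
    rw [← h.norm_iterate]
    exact norm_eq_of_norm_sub_lt (by rwa [h.norm_iterate])
  have hsmall : ∀ τ > 0, ∃ v ∈ Metric.closedBall (e k) ((multiplier p r k ^ ℓ)⁻¹ / r k),
      ‖(entireMap p (Function.update e k v))^[ℓ + N] x‖ < τ := by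
    intro τ hτ
    obtain ⟨m, hm⟩ := exists_norm_sq_eq_multiplier hr hpK h.norm_coeff k
    set v₁ := e k + e k / (m ^ 2) ^ ℓ with hv₁
    have hv₁d : ‖v₁ - e k‖ = (multiplier p r k ^ ℓ)⁻¹ / r k := by
      rw [hv₁, add_sub_cancel_left, norm_div, norm_pow, norm_pow, hm, h.norm_coeff]
      ring
    have hga₁ : ‖entireMap p (Function.update e k v₁) a - a‖
        = multiplier p r k * (r k * (multiplier p r k ^ ℓ)⁻¹) := by
      have h1 := h.norm_update_sub hr hpK hv₁d.le
      rw [hv₁d, hd] at h1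
      rw [← sub_add_sub_cancel _ (entireMap p e a), add_comm, norm_add_eq_of_lt, h1]
      rw [h1]
      exact h.norm_sub_lt.trans hδlt
    have hend : ‖(entireMap p (Function.update e k v₁))^[ℓ + N] x - a‖ = r k := by
      obtain ⟨i, rfl⟩ : ∃ i, ℓ = i + 1 := ⟨ℓ - 1, by have := h.pos; omega⟩
      rw [Function.iterate_add_apply, norm_iterate_succ_sub_of_expanding
        (h.expanding hr hpK hv₁d.le) hlam hδ hR hga₁ (hstable v₁ hv₁d.le).1 le_rfl, hR]
    have hpoly := polyApprox_iterate (S := Metric.closedBall (e k) ‖v₁ - e k‖) hr hpK (x := C x)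
      (E := E) (fun v _ => by simpa using h.norm_le_one)
      (fun v hv j => by
        rw [hEj]
        refine (h.norm_update hr ?_ j).le
        rw [← hv₁d]
        exact mem_closedBall_iff_norm.1 hv) (ℓ + N)
    simp only [hE, eval_C] at hpoly
    obtain ⟨v, hv, hvτ⟩ := hpoly.exists_norm_sub_lt (w := 0) (by
      simp only [Function.update_eq_self]
      rw [zero_sub, norm_neg, hself', ← sub_sub_sub_cancel_right _ _ a, norm_sub_rev,
        norm_sub_eq_of_lt (by rwa [hend]), hend]) hτ
    refine ⟨v, ?_, by simpa using hvτ⟩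
    rwa [mem_closedBall_iff_norm, ← hv₁d]
  have hdisk : ∀ v ∈ Metric.closedBall (e k) ((multiplier p r k ^ ℓ)⁻¹ / r k), ∀ y,
      ‖y - x‖ < rho p ^ 2 → ‖(entireMap p (Function.update e k v))^[ℓ + N] y
        - (entireMap p (Function.update e k v))^[ℓ + N] x‖ < rho p ^ 2 := by
    intro v hv y hy
    rw [mem_closedBall_iff_norm] at hv
    rw [Function.iterate_add_apply, Function.iterate_add_apply]
    obtain ⟨h1, h2⟩ := hstable v hv
    have h3 := (h2 y hy).1
    have h4 : rho p ^ 2 * (multiplier p r k ^ ℓ)⁻¹ ≤ r k * (multiplier p r k ^ ℓ)⁻¹ := by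
      gcongr
      exact hρ2.le.trans (hr.one_lt k).le
    rw [norm_iterate_sub_eq_of_expanding (h.expanding hr hpK hv) hlam hδ hR (hga v hv)
      (norm_sub_le_of_le (h3.le.trans h4) h1.le) h1.le le_rfl]
    calc _ < multiplier p r k ^ ℓ * (rho p ^ 2 * (multiplier p r k ^ ℓ)⁻¹) := by gcongr
      _ = rho p ^ 2 := by field_simp
  obtain ⟨v, hv, N', ℓ', hd', h'⟩ := exists_landing (e₀ := e₀) (k := k + 1) (c := e k)
    (ρ := (multiplier p r k ^ ℓ)⁻¹ / r k) (E := E) (x := C x) (L := ℓ + N) hr hpK hgen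
    (fun v hv j => by
      rw [hEj]
      exact h.norm_update hr (mem_closedBall_iff_norm.1 hv) j)
    (fun v _ j hj => by
      rw [hEj, Function.update_of_ne (by omega)]
      exact h.coeff_eq j (by omega))
    (fun v _ => by simpa using h.norm_le_one)
    (by have := h.pos; have := h.le; omega) (by simpa only [hE, eval_C] using hsmall)
    ⟨e k, Metric.mem_closedBall_self hd0.le, by
      rw [hE, eval_C, Function.update_eq_self, hself']
      exact (hr.one_lt k).le⟩
    (by simpa only [hE, eval_C] using hdisk) hd₀
  rw [hE, eval_C] at h'
  exact ⟨v, N', ℓ', mem_closedBall_iff_norm.1 hv, hd', h'⟩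

end Landing

variable [IsUltrametricDist K] [CompleteSpace K] [IsAlgClosed K]

lemma exists_landing_zero (hr : RadiusSeq p r) (hpK : ‖(p : K)‖ = (p : ℝ)⁻¹)
    (hgen : ∀ i j n, i < j → 1 ≤ n → (growth p r)^[n] (r i) ≠ r j)
    (he₀ : ∀ j, ‖e₀ j‖ = (r j)⁻¹) {d₀ : ℝ} (hd₀ : 0 < d₀) :
    ∃ x N ℓ, (multiplier p r 0 ^ ℓ)⁻¹ / r 0 ≤ d₀ ∧ Landing p r e₀ 0 e₀ x N ℓ := by
  obtain ⟨v, -, N, ℓ, hd, h⟩ := exists_landing (e₀ := e₀) (k := 0) (c := (0 : K)) (ρ := 1)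
    (E := fun j => C (e₀ j)) (x := X) (L := 0) hr hpK hgen (fun v _ j => by simpa using he₀ j)
    (fun v _ j _ => eval_C) (fun v hv => by simpa using hv) le_rfl
    (fun τ hτ => ⟨0, by simp, by simpa using hτ⟩) ⟨1, by simp, by simp⟩
    (fun v _ y hy => by simpa using hy) hd₀
  exact ⟨v, N, ℓ, hd, by simpa using h⟩

end Induction

section Limit

lemma exists_seq_of_forall_exists {α : Type*} {P : ℕ → α → Prop} {T : ℕ → α → α → Prop} {a : α}
    (h0 : P 0 a) (hs : ∀ k a, P k a → ∃ b, P (k + 1) b ∧ T k a b) :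
    ∃ s : ℕ → α, s 0 = a ∧ ∀ k, P k (s k) ∧ T k (s k) (s (k + 1)) := by
  choose! g hg using hs
  let s : ℕ → α := fun k => Nat.rec a g k
  have hP : ∀ k, P k (s k) := by
    intro k
    induction k with
    | zero => exact h0
    | succ k ih => exact (hg k _ ih).1
  exact ⟨s, rfl, fun k => ⟨hP k, (hg k _ (hP k)).2⟩⟩

variable {p : ℕ} [hp : Fact p.Prime] {r : ℕ → ℝ} {K : Type*} [NontriviallyNormedField K]
  [IsUltrametricDist K] {e₀ : ℕ → K}

lemma Landing.norm_iterate_eq (hr : RadiusSeq p r) {k : ℕ} {e : ℕ → K} {x : K} {N ℓ : ℕ}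
    (h : Landing p r e₀ k e x N ℓ) {e' : ℕ → K} (he' : ∀ j, ‖e' j‖ = (r j)⁻¹)
    (hd : ∀ j, ‖e' j - e j‖ ≤ (multiplier p r k ^ ℓ)⁻¹ / r k) {y : K}
    (hy : ‖y - x‖ < rho p ^ 2) : ‖(entireMap p e')^[N] y‖ = r k := by
  obtain ⟨h1, h2⟩ := h.stable e' he' hd
  have h3 := (h2 y hy).1
  have h4 := h.inv_pow_lt_one hr
  have hm : 0 < (multiplier p r k ^ ℓ)⁻¹ := by
    have := one_lt_multiplier hr k
    positivity
  have hrk := hr.one_lt k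
  have hρ : rho p ^ 2 < r k := lt_trans (pow_lt_one₀ rho_pos.le rho_lt_one two_ne_zero) hrk
  rw [← h.norm_iterate]
  refine norm_eq_of_norm_sub_lt ?_
  rw [h.norm_iterate]
  refine norm_sub_lt_of_lt (h3.trans ?_) (h1.trans ?_) <;> nlinarith

variable [CompleteSpace K] [IsAlgClosed K]

theorem exists_oscillating (hr : RadiusSeq p r) (hpK : ‖(p : K)‖ = (p : ℝ)⁻¹)
    (hgen : ∀ i j n, i < j → 1 ≤ n → (growth p r)^[n] (r i) ≠ r j)
    (he₀ : ∀ j, ‖e₀ j‖ = (r j)⁻¹) {ε : ℕ → ℝ} (hε : ∀ j, 0 < ε j) :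
    ∃ e : ℕ → K, (∀ j, ‖e j‖ = (r j)⁻¹) ∧ (∀ j, ‖e j - e₀ j‖ ≤ ε j) ∧
      ∃ x : K, ∀ y : K, ‖y - x‖ < rho p ^ 2 →
        (∀ M : ℝ, ∃ n : ℕ, M < ‖(entireMap p e)^[n] y‖) ∧
        (∀ N : ℕ, ∃ n : ℕ, N ≤ n ∧ ‖(entireMap p e)^[n] y‖ < 1) := by
  obtain ⟨x, N₀, ℓ₀, hd₀, h₀⟩ := exists_landing_zero hr hpK hgen he₀ (hε 0)
  let d : ℕ → ((ℕ → K) × ℕ × ℕ) → ℝ := fun k s => (multiplier p r k ^ s.2.2)⁻¹ / r k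
  have hdpos : ∀ k s, 0 < d k s := fun k s => by
    have := one_lt_multiplier hr k
    have := hr.pos k
    positivity
  obtain ⟨s, -, hs⟩ := exists_seq_of_forall_exists (a := (e₀, N₀, ℓ₀))
    (P := fun k s => Landing p r e₀ k s.1 x s.2.1 s.2.2 ∧ d k s ≤ ε k)
    (T := fun k s t => (∃ v, ‖v - s.1 k‖ ≤ d k s ∧ t.1 = Function.update s.1 k v) ∧
      d (k + 1) t ≤ d k s) ⟨h₀, hd₀⟩ (fun k s hs => by
      obtain ⟨v, N', ℓ', hv, hd', h'⟩ := hs.1.exists_succ hr hpK hgen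
        (lt_min (hdpos k s) (hε (k + 1)))
      exact ⟨(Function.update s.1 k v, N', ℓ'), ⟨h', hd'.trans (min_le_right _ _)⟩,
        ⟨v, hv, rfl⟩, hd'.trans (min_le_left _ _)⟩)
  have hland := fun k => (hs k).1.1
  have hanti : Antitone fun k => d k (s k) := antitone_nat_of_succ_le fun k => (hs k).2.2
  let e : ℕ → K := fun j => (s (j + 1)).1 j
  have hstep : ∀ k j, j ≠ k → (s (k + 1)).1 j = (s k).1 j := by
    intro k j hj
    obtain ⟨⟨v, -, hv⟩, -⟩ := (hs k).2
    rw [hv, Function.update_of_ne hj]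
  have hlt : ∀ k j, j < k → (s k).1 j = e j := by
    intro k j hj
    induction k, hj using Nat.le_induction with
    | base => rfl
    | succ k hk ih => rw [hstep k j (by omega), ih]
  have hclose : ∀ j, ‖e j - e₀ j‖ ≤ d j (s j) := by
    intro j
    obtain ⟨⟨v, hvd, hv⟩, -⟩ := (hs j).2
    simpa only [e, hv, Function.update_self, ← (hland j).coeff_eq j le_rfl] using hvd
  have he : ∀ j, ‖e j‖ = (r j)⁻¹ := fun j => (hland (j + 1)).norm_coeff j
  have hd : ∀ k j, ‖e j - (s k).1 j‖ ≤ d k (s k) := by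
    intro k j
    rcases lt_or_ge j k with hj | hj
    · rw [hlt k j hj, sub_self, norm_zero]
      exact (hdpos _ _).le
    · rw [(hland k).coeff_eq j hj]
      exact (hclose j).trans (hanti hj)
  refine ⟨e, he, fun j => (hclose j).trans (hs j).1.2, x, fun y hy => ⟨fun M => ?_, fun N => ?_⟩⟩
  · obtain ⟨k, hk⟩ := (hr.tendsto.eventually_gt_atTop M).exists
    exact ⟨_, hk.trans_eq ((hland k).norm_iterate_eq hr he (hd k) hy).symm⟩
  · exact (((hland N).stable e he (hd N)).2 y hy).2

end Limit

lemma RadiusSeq.of_isRadii {p : ℕ} {R : ℕ → ℝ} (hR : IsRadii p R) :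
    RadiusSeq p fun j => R (j + 1) where
  strictMono := strictMono_nat_of_lt_succ fun j => hR.1 (j + 1) (by omega)
  lt_zero := hR.2.1
  tendsto := hR.2.2.comp (Filter.tendsto_add_atTop_nat 1)

lemma phi_eq_growth {p : ℕ} {R : ℕ → ℝ} (hR : IsRadii p R) (t : ℝ) :
    phi p R t = growth p (fun j => R (j + 1)) t := by
  have hr := RadiusSeq.of_isRadii hR
  have hne : {j : ℕ | 1 ≤ j ∧ t ≤ R j}.Nonempty :=
    ((Filter.eventually_ge_atTop 1).and (hR.2.2.eventually_ge_atTop t)).exists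
  obtain ⟨hj, htj⟩ := Nat.sInf_mem hne
  have hmin : ∀ i, 1 ≤ i → i < sInf {j : ℕ | 1 ≤ j ∧ t ≤ R j} → R i < t := fun i hi hij =>
    not_le.1 fun hti => Nat.notMem_of_lt_sInf hij ⟨hi, hti⟩
  simp only [phi]
  generalize sInf {j : ℕ | 1 ≤ j ∧ t ≤ R j} = j at hj htj hmin
  obtain ⟨m, rfl⟩ := Nat.exists_eq_add_of_le' hj
  have hprod : ∏ i ∈ Finset.range m, max 1 (t / R (i + 1))
      = t ^ m * (∏ i ∈ Finset.Icc 1 m, R i)⁻¹ := by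
    rw [Finset.range_eq_Ico, Finset.prod_congr rfl (g := fun i => t * (R (i + 1))⁻¹)]
    · rw [Finset.prod_mul_distrib, Finset.prod_inv_distrib, Finset.prod_Ico_add' R 0 m 1]
      simp [Finset.Ico_add_one_right_eq_Icc]
    · intro i hi
      rw [max_eq_right, div_eq_mul_inv]
      rw [one_le_div (hr.pos i)]
      exact (hmin (i + 1) (by omega) (by simp at hi; omega)).le
  rw [growth_eq hr htj, hprod, Nat.add_sub_cancel, ← add_assoc, Nat.add_sub_cancel, pow_add]
  ring

lemma fc_eq_entireMap (p : ℕ) {K : Type*} [NormedField K] (c : ℕ → K) :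
    fc p c = entireMap p fun j => (c (j + 1))⁻¹ := by
  funext z
  simp only [fc, entireMap, div_eq_inv_mul z (c _)]

end OscillatingMap

/-- **Theorem A** (classical-points form). For a generic sequence of radii `r` and any
sequence of positive `ε_j`, every `c ∈ C(r)` admits a perturbation `c' ∈ C(r)` with
`|c_j - c'_j| < ε_j` for all `j ≥ 1`, together with a point `x` such that every `y`
with `|y - x| < ϱ²` has an oscillating orbit under `f_{c'}`: the orbit is unbounded
yet returns infinitely often to the unit disk. -/
theorem oscillating_wandering_domain
    (p : ℕ) [Fact p.Prime] (K : Type*) [NontriviallyNormedField K] [Algebra ℚ_[p] K]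
    (hK : IsCp p K) (R : ℕ → ℝ) (hR : IsGenericRadii p R)
    (ε : ℕ → ℝ) (hε : ∀ j, 1 ≤ j → 0 < ε j)
    (c : ℕ → K) (hc : InC p R c) :
    ∃ c' : ℕ → K, InC p R c' ∧ (∀ j, 1 ≤ j → ‖c j - c' j‖ < ε j) ∧
      ∃ x : K, ∀ y : K, ‖y - x‖ < rho p ^ 2 →
        (∀ M : ℝ, ∃ n : ℕ, M < ‖(fc p c')^[n] y‖) ∧
        (∀ N : ℕ, ∃ n : ℕ, N ≤ n ∧ ‖(fc p c')^[n] y‖ < 1) := by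
  have := hK.complete
  have := hK.isAlgClosed
  have : IsUltrametricDist K :=
    IsUltrametricDist.isUltrametricDist_of_forall_norm_add_le_max_norm hK.isNonarch
  have hpK : ‖(p : K)‖ = (p : ℝ)⁻¹ := by
    simpa using hK.norm_extends p
  have hr := OscillatingMap.RadiusSeq.of_isRadii hR.1
  have hgen : ∀ i j n, i < j → 1 ≤ n →
      (OscillatingMap.growth p fun j => R (j + 1))^[n] (R (i + 1)) ≠ R (j + 1) := by
    intro i j n hij hn
    rw [← funext (OscillatingMap.phi_eq_growth hR.1)]
    exact hR.2 (i + 1) (j + 1) n (by omega) (by omega) hn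
  have hε' : ∀ j, 0 < ε (j + 1) / (2 * R (j + 1) ^ 2) := fun j => by
    have := hr.pos j
    have := hε (j + 1) (by omega)
    positivity
  obtain ⟨e, he, hed, x, hx⟩ := OscillatingMap.exists_oscillating hr hpK hgen
    (e₀ := fun j => (c (j + 1))⁻¹) (fun j => by rw [norm_inv, hc (j + 1) (by omega)]) hε'
  refine ⟨fun j => (e (j - 1))⁻¹, fun j hj => ?_, fun j hj => ?_, x, fun y hy => ?_⟩
  · obtain ⟨j, rfl⟩ := Nat.exists_eq_add_of_le' hj
    simp [he]
  · obtain ⟨j, rfl⟩ := Nat.exists_eq_add_of_le' hj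
    have hRj : 0 < R (j + 1) := hr.pos j
    have hεj := hε (j + 1) hj
    have hc0 : c (j + 1) ≠ 0 := by rw [← norm_pos_iff, hc _ hj]; exact hRj
    have he0 : e j ≠ 0 := by rw [← norm_pos_iff, he]; positivity
    have heq : c (j + 1) - (e j)⁻¹ = c (j + 1) * (e j)⁻¹ * (e j - (c (j + 1))⁻¹) := by
      field_simp
    beta_reduce
    rw [Nat.add_sub_cancel, heq, norm_mul, norm_mul, norm_inv, he, inv_inv, hc _ hj]
    calc _ ≤ R (j + 1) * R (j + 1) * (ε (j + 1) / (2 * R (j + 1) ^ 2)) := by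
          gcongr
          exact hed j
      _ = ε (j + 1) / 2 := by field_simp
      _ < ε (j + 1) := half_lt_self hεj
  · rw [OscillatingMap.fc_eq_entireMap]
    simpa using hx y hy
end
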